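/- arXiv:2404.16338 — 2 statements merged into one kernel-verified Lean document; each statement's English description precedes it below -/
import Mathlib

section
/- Let n ≥ 0 and α ≥ n be real, and let f ∈ T^α(ℝ). Then there exist finitely many tuples β^{(1)}, …, β^{(L)} ∈ ℝ^{n+1} with Σ_{j=0}^n β^{(i)}_j = α − n for each i, and functions φ_i ∈ S^{β^{(i)}_0}(ℝ) ⊠_i ⋯ ⊠_i S^{β^{(i)}_n}(ℝ) such that f^{[n]} = φ_1 + ⋯ + φ_L, where for all integers k_0, …, k_n ≥ 0 each φ_i satisfies ‖φ_i‖_{k_0,…,k_n} ≤ C · Σ_{r=0}^{n + k_0 + ⋯ + k_n + 2} ‖f‖_{T^α,r} with C independent of f. -/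
open MeasureTheory Filter Topology
open scoped ENNReal NNReal

noncomputable section

/-- The Japanese bracket `⟨x⟩ = (1 + x²)^(1/2)`. -/
def jb (x : ℝ) : ℝ := Real.sqrt (1 + x ^ 2)

/-- The weight `‖f⁽ᵏ⁾(x)‖ ⟨x⟩^(k−β)` defining the `S^β` seminorms. -/
def sWeight (β : ℝ) (k : ℕ) (f : ℝ → ℂ) (x : ℝ) : ℝ :=
  ‖iteratedDeriv k f x‖ * jb x ^ ((k : ℝ) - β)

/-- The `S^β` seminorm `‖f‖_{S^β,k} = sup_x ‖f⁽ᵏ⁾(x)‖ ⟨x⟩^(k−β)`. -/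
def SNorm (β : ℝ) (k : ℕ) (f : ℝ → ℂ) : ℝ := ⨆ x : ℝ, sWeight β k f x

/-- Membership in `S^β(ℝ)`: smooth with all the seminorms finite. -/
def MemS (β : ℝ) (f : ℝ → ℂ) : Prop :=
  ContDiff ℝ (⊤ : ℕ∞) f ∧ ∀ k : ℕ, BddAbove (Set.range (sWeight β k f))

/-- The weight `‖f⁽ᵏ⁾(x)‖ ⟨x⟩^(k−β−1)` defining the `T^β` seminorms. -/
def tWeight (β : ℝ) (k : ℕ) (f : ℝ → ℂ) (x : ℝ) : ℝ :=
  ‖iteratedDeriv k f x‖ * jb x ^ ((k : ℝ) - β - 1)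

/-- The `T^β` seminorm `‖f‖_{T^β,k} = ∫ ‖f⁽ᵏ⁾(x)‖ ⟨x⟩^(k−β−1) dx`. -/
def TNorm (β : ℝ) (k : ℕ) (f : ℝ → ℂ) : ℝ := ∫ x : ℝ, tWeight β k f x

/-- Membership in `T^β(ℝ)`: smooth with all the seminorms finite. -/
def MemT (β : ℝ) (f : ℝ → ℂ) : Prop :=
  ContDiff ℝ (⊤ : ℕ∞) f ∧ ∀ k : ℕ, Integrable (tWeight β k f)

/-- `F` is the sequence of divided differences of `f`: `F 0 = f`, each `F m` is
continuous, and the divided-difference recursion holds off the diagonal. -/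
def IsDivDiff (f : ℝ → ℂ) (F : (m : ℕ) → (Fin (m + 1) → ℝ) → ℂ) : Prop :=
  (∀ x : Fin 1 → ℝ, F 0 x = f (x 0)) ∧
  (∀ m, Continuous (F m)) ∧
  (∀ m, ∀ x : Fin (m + 2) → ℝ, x 0 ≠ x (Fin.last (m + 1)) →
    F (m + 1) x = (F m (fun i => x i.succ) - F m (fun i => x i.castSucc)) /
      ((x 0 - x (Fin.last (m + 1)) : ℝ) : ℂ))

end
noncomputable section

open MeasureTheory
open scoped ENNReal

/-- `(Ω, mΩ, ν, a)` is an admissible integral representation of the symbol `φ`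
witnessing membership in `S^{β 0}(ℝ) ⊠ᵢ ⋯ ⊠ᵢ S^{β n}(ℝ)`. -/
def IsBoxRep {n : ℕ} (β : Fin (n + 1) → ℝ) (φ : (Fin (n + 1) → ℝ) → ℂ)
    (Ω : Type) (mΩ : MeasurableSpace Ω) (ν : @Measure Ω mΩ)
    (a : Fin (n + 1) → ℝ → Ω → ℂ) : Prop :=
  SigmaFinite ν ∧
  (∀ j, Measurable (Function.uncurry (a j))) ∧
  (∀ j ω, MemS (β j) (fun x => a j x ω)) ∧
  (∀ j k, Measurable fun ω => SNorm (β j) k (fun x => a j x ω)) ∧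
  (∀ lam : Fin (n + 1) → ℝ, φ lam = ∫ ω, ∏ j, a j (lam j) ω ∂ν) ∧
  (∀ k : Fin (n + 1) → ℕ,
    Integrable (fun ω => ∏ j, SNorm (β j) (k j) (fun x => a j x ω)) ν)

/-- Membership of `φ` in `S^{β 0}(ℝ) ⊠ᵢ ⋯ ⊠ᵢ S^{β n}(ℝ)`. -/
def MemBox {n : ℕ} (β : Fin (n + 1) → ℝ) (φ : (Fin (n + 1) → ℝ) → ℂ) : Prop :=
  ∃ (Ω : Type) (mΩ : MeasurableSpace Ω) (ν : @Measure Ω mΩ)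
    (a : Fin (n + 1) → ℝ → Ω → ℂ), IsBoxRep β φ Ω mΩ ν a

/-- The seminorm `‖φ‖_{k_0,…,k_n}` of `S^{β 0}(ℝ) ⊠ᵢ ⋯ ⊠ᵢ S^{β n}(ℝ)`: the infimum,
over all admissible representations, of `∫ ∏_j ‖a_j(·,ω)‖_{S^{β_j},k_j} dν(ω)`. -/
def boxNorm {n : ℕ} (β : Fin (n + 1) → ℝ) (k : Fin (n + 1) → ℕ)
    (φ : (Fin (n + 1) → ℝ) → ℂ) : ℝ≥0∞ :=
  sInf { M : ℝ≥0∞ | ∃ (Ω : Type) (mΩ : MeasurableSpace Ω) (ν : @Measure Ω mΩ)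
    (a : Fin (n + 1) → ℝ → Ω → ℂ), IsBoxRep β φ Ω mΩ ν a ∧
    M = ∫⁻ ω, ∏ j, ENNReal.ofReal (SNorm (β j) (k j) (fun x => a j x ω)) ∂ν }

end

/-- The divided difference of `v` at the nodes `z a, …, z (a + n)`, with the sign convention of
`IsDivDiff`. -/
noncomputable def divDiff (v : ℝ → ℂ) (z : ℕ → ℝ) : ℕ → ℕ → ℂ
  | a, 0 => v (z a)
  | a, n + 1 => (divDiff v z (a + 1) n - divDiff v z a n) / ((z a - z (a + n + 1) : ℝ) : ℂ)

lemma divDiff_succ_mul (v : ℝ → ℂ) {z : ℕ → ℝ} {a n : ℕ} (h : z a ≠ z (a + n + 1)) :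
    ((z a - z (a + n + 1) : ℝ) : ℂ) * divDiff v z a (n + 1) =
      divDiff v z (a + 1) n - divDiff v z a n := by
  have : ((z a - z (a + n + 1) : ℝ) : ℂ) ≠ 0 := by
    exact_mod_cast sub_ne_zero.2 h
  rw [divDiff]
  field_simp

lemma divDiff_hasSum {ι : Type*} {v : ι → ℝ → ℂ} {g : ℝ → ℂ} (z : ℕ → ℝ)
    (h : ∀ x, HasSum (fun i => v i x) (g x)) (a n : ℕ) :
    HasSum (fun i => divDiff (v i) z a n) (divDiff g z a n) := by
  induction n generalizing a with
  | zero => exact h _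
  | succ n ih => exact ((ih (a + 1)).sub (ih a)).div_const _

/-- The Leibniz rule for divided differences. -/
lemma divDiff_mul (u v : ℝ → ℂ) {z : ℕ → ℝ} (a n : ℕ)
    (hz : Set.InjOn z (Set.Icc a (a + n))) :
    divDiff (fun x => u x * v x) z a n =
      ∑ q ∈ Finset.HasAntidiagonal.antidiagonal n,
        divDiff u z a q.1 * divDiff v z (a + q.1) q.2 := by
  induction n generalizing a with
  | zero => simp [divDiff]
  | succ n ih =>
    have hne : ∀ i j, a ≤ i → i < j → j ≤ a + (n + 1) → z i ≠ z j := fun i j h1 h2 h3 h =>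
      h2.ne (hz ⟨h1, by omega⟩ ⟨by omega, h3⟩ h)
    have h0 : ((z a - z (a + n + 1) : ℝ) : ℂ) ≠ 0 := by
      exact_mod_cast sub_ne_zero.2 (hne a (a + n + 1) le_rfl (by omega) (by omega))
    rw [divDiff, ih (a + 1) (hz.mono (Set.Icc_subset_Icc (by omega) (by omega))),
      ih a (hz.mono (Set.Icc_subset_Icc le_rfl (by omega))), div_eq_iff h0, Finset.sum_mul,
      ← Finset.sum_sub_distrib]
    have hsplit : ∀ q ∈ Finset.HasAntidiagonal.antidiagonal (n + 1),
        divDiff u z a q.1 * divDiff v z (a + q.1) q.2 * ((z a - z (a + n + 1) : ℝ) : ℂ) =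
        ((z a - z (a + q.1) : ℝ) : ℂ) * divDiff u z a q.1 * divDiff v z (a + q.1) q.2 +
        divDiff u z a q.1 *
          (((z (a + q.1) - z (a + q.1 + q.2) : ℝ) : ℂ) * divDiff v z (a + q.1) q.2) := by
      intro q hq
      have hq' := Finset.HasAntidiagonal.mem_antidiagonal.1 hq
      rw [show a + q.1 + q.2 = a + n + 1 by omega]
      push_cast
      ring
    rw [Finset.sum_congr rfl hsplit, Finset.sum_add_distrib, Finset.Nat.sum_antidiagonal_succ]
    rw [Finset.Nat.sum_antidiagonal_succ']
    simp only [add_zero, sub_self, Complex.ofReal_zero, zero_mul, mul_zero, zero_add,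
      ← Finset.sum_add_distrib]
    refine Finset.sum_congr rfl fun q hq => ?_
    have hq' := Finset.HasAntidiagonal.mem_antidiagonal.1 hq
    have e1 := divDiff_succ_mul u (hne a (a + q.1 + 1) le_rfl (by omega) (by omega))
    have e2 := divDiff_succ_mul v
      (hne (a + q.1) (a + q.1 + q.2 + 1) (by omega) (by omega) (by omega))
    rw [← add_assoc a q.1 1, ← add_assoc (a + q.1) q.2 1, e1, e2,
      show a + 1 + q.1 = a + q.1 + 1 by omega]
    ring

/-- Divided differences of the coefficients of a family of power series which satisfies a
resolvent-type identity. -/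
lemma divDiff_coeff {R : ℝ → PowerSeries ℂ} {E : PowerSeries ℂ}
    (hR : ∀ x y : ℝ, R y - R x = PowerSeries.C ((x - y : ℝ) : ℂ) * E * R x * R y)
    {z : ℕ → ℝ} (k a n : ℕ) (hz : Set.InjOn z (Set.Icc a (a + n))) :
    divDiff (fun x => PowerSeries.coeff k (R x)) z a n =
      PowerSeries.coeff k (E ^ n * ∏ i ∈ Finset.range (n + 1), R (z (a + i))) := by
  induction n generalizing a with
  | zero => simp [divDiff]
  | succ n ih =>
    have h0 : ((z a - z (a + n + 1) : ℝ) : ℂ) ≠ 0 := by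
      have : z a ≠ z (a + n + 1) := fun h => by
        have := hz ⟨le_rfl, by omega⟩ ⟨by omega, by omega⟩ h
        omega
      exact_mod_cast sub_ne_zero.2 this
    rw [divDiff, ih (a + 1) (hz.mono (Set.Icc_subset_Icc (by omega) (by omega))),
      ih a (hz.mono (Set.Icc_subset_Icc le_rfl (by omega))), div_eq_iff h0, ← map_sub,
      mul_comm (PowerSeries.coeff k _), ← PowerSeries.coeff_C_mul]
    congr 1
    rw [Finset.prod_range_succ, Finset.prod_range_succ' _ n, Finset.prod_range_succ _ (n + 1),
      Finset.prod_range_succ' _ n]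
    simp only [add_zero, show ∀ i, a + 1 + i = a + (i + 1) by intro i; omega]
    have := hR (z a) (z (a + (n + 1)))
    linear_combination (E ^ n * ∏ i ∈ Finset.range n, R (z (a + (i + 1)))) * this

lemma IsDivDiff.eq_divDiff {f : ℝ → ℂ} {F : (m : ℕ) → (Fin (m + 1) → ℝ) → ℂ}
    (hF : IsDivDiff f F) {z : ℕ → ℝ} (a n : ℕ) (hz : Set.InjOn z (Set.Icc a (a + n))) :
    F n (fun i => z (a + i)) = divDiff f z a n := by
  induction n generalizing a with
  | zero => simpa [divDiff] using hF.1 _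
  | succ n ih =>
    rw [hF.2.2 n _ (fun h => ?_), divDiff,
      ← ih (a + 1) (hz.mono (Set.Icc_subset_Icc (by omega) (by omega))),
      ← ih a (hz.mono (Set.Icc_subset_Icc le_rfl (by omega)))]
    · simp only [Fin.val_succ, Fin.val_castSucc, Fin.val_zero, Fin.val_last, add_zero,
        show ∀ i, a + 1 + i = a + (i + 1) by intro i; omega, add_assoc]
    · have := hz ⟨by simp, by simp⟩ ⟨by simp, by simp⟩ h
      simp at this

lemma frequently_injective_add_mul {m : ℕ} (x : Fin m → ℝ) :
    ∀ᶠ ε : ℝ in 𝓝[≠] 0, Function.Injective fun i : Fin m => x i + ε * (i : ℝ) := by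
  have key : ∀ i j : Fin m, i ≠ j →
      ∀ᶠ ε : ℝ in 𝓝[≠] 0, x i + ε * (i : ℝ) ≠ x j + ε * (j : ℝ) := by
    intro i j hij
    have hij' : (i : ℝ) - (j : ℝ) ≠ 0 := by
      rw [sub_ne_zero]
      exact_mod_cast fun h => hij (Fin.ext h)
    have hfin : ∀ᶠ ε : ℝ in 𝓝[≠] 0, ε ≠ (x j - x i) / ((i : ℝ) - j) := by
      rcases eq_or_ne ((x j - x i) / ((i : ℝ) - j)) 0 with h | h
      · rw [h]
        exact self_mem_nhdsWithin
      · exact nhdsWithin_le_nhds (isOpen_ne.mem_nhds h.symm)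
    filter_upwards [hfin] with ε hε h
    apply hε
    rw [eq_div_iff hij']
    linarith
  have := eventually_all.2 fun i => eventually_all.2 fun j => eventually_all.2 (key i j)
  filter_upwards [this] with ε hε i j hij
  by_contra h
  exact hε i j h hij

lemma eq_of_eq_on_injective {m : ℕ} {G H : (Fin m → ℝ) → ℂ} (hG : Continuous G)
    (hH : Continuous H) (h : ∀ x, Function.Injective x → G x = H x) : G = H := by
  funext x
  have hc : ∀ K : (Fin m → ℝ) → ℂ, Continuous K →
      Tendsto (fun ε : ℝ => K fun i => x i + ε * (i : ℝ)) (𝓝[≠] 0) (𝓝 (K x)) := by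
    intro K hK
    have : Continuous fun ε : ℝ => K fun i => x i + ε * (i : ℝ) := by fun_prop
    simpa using (this.tendsto 0).mono_left nhdsWithin_le_nhds
  refine tendsto_nhds_unique ((hc G hG).congr' ?_) (hc H hH)
  filter_upwards [frequently_injective_add_mul x] with ε hε using h _ hε

lemma one_le_jb (x : ℝ) : 1 ≤ jb x := by
  rw [jb, Real.one_le_sqrt]
  nlinarith [sq_nonneg x]

lemma jb_pos (x : ℝ) : 0 < jb x := one_pos.trans_le (one_le_jb x)

lemma continuous_jb : Continuous jb := by
  unfold jb
  fun_prop

lemma sWeight_nonneg (β : ℝ) (k : ℕ) (f : ℝ → ℂ) (x : ℝ) : 0 ≤ sWeight β k f x :=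
  mul_nonneg (norm_nonneg _) (Real.rpow_nonneg (jb_pos x).le _)

lemma SNorm_nonneg (β : ℝ) (k : ℕ) (f : ℝ → ℂ) : 0 ≤ SNorm β k f :=
  Real.iSup_nonneg (sWeight_nonneg β k f)

lemma sWeight_const_mul (β : ℝ) (k : ℕ) (w : ℂ) (f : ℝ → ℂ) (x : ℝ) :
    sWeight β k (fun y => w * f y) x = ‖w‖ * sWeight β k f x := by
  simp only [sWeight, iteratedDeriv_const_mul_field, norm_mul, mul_assoc]

lemma SNorm_const_mul (β : ℝ) (k : ℕ) (w : ℂ) (f : ℝ → ℂ) :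
    SNorm β k (fun y => w * f y) = ‖w‖ * SNorm β k f := by
  simp only [SNorm, sWeight_const_mul, Real.mul_iSup_of_nonneg (norm_nonneg w)]

lemma MemS.const_mul {β : ℝ} {f : ℝ → ℂ} (hf : MemS β f) (w : ℂ) :
    MemS β (fun y => w * f y) := by
  refine ⟨contDiff_const.mul hf.1, fun k => ?_⟩
  obtain ⟨B, hB⟩ := hf.2 k
  refine ⟨‖w‖ * B, ?_⟩
  rintro _ ⟨x, rfl⟩
  rw [sWeight_const_mul]
  exact mul_le_mul_of_nonneg_left (hB ⟨x, rfl⟩) (norm_nonneg w)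

lemma MemS.norm_mul_jb_le {β : ℝ} {f : ℝ → ℂ} (hf : MemS β f) (x : ℝ) :
    ‖f x‖ * jb x ^ (-β) ≤ SNorm β 0 f := by
  have h : sWeight β 0 f x ≤ SNorm β 0 f := le_ciSup (hf.2 0) x
  rwa [sWeight, iteratedDeriv_zero, Nat.cast_zero, zero_sub] at h

section BoxSum

variable {n : ℕ} {Ω : Type} {β : Fin (n + 1) → ℝ} {w : Ω → ℂ} {a : Fin (n + 1) → Ω → ℝ → ℂ}

/-- Multiply the zeroth factor of a product representation by the weight `w`. -/
def absorbWeight (w : Ω → ℂ) (a : Fin (n + 1) → Ω → ℝ → ℂ) (j : Fin (n + 1)) (x : ℝ) (ω : Ω) :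
    ℂ :=
  (if j = 0 then w ω else 1) * a j ω x

lemma prod_ite_zero_eq {M : Type*} [CommMonoid M] (c : M) :
    ∏ j : Fin (n + 1), (if j = 0 then c else 1) = c := by
  simp

lemma prod_absorbWeight (x : Fin (n + 1) → ℝ) (ω : Ω) :
    ∏ j, absorbWeight w a j (x j) ω = w ω * ∏ j, a j ω (x j) := by
  simp only [absorbWeight, Finset.prod_mul_distrib, prod_ite_zero_eq]

lemma prod_SNorm_absorbWeight (k : Fin (n + 1) → ℕ) (ω : Ω) :
    ∏ j, SNorm (β j) (k j) (fun x => absorbWeight w a j x ω) =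
      ‖w ω‖ * ∏ j, SNorm (β j) (k j) (a j ω) := by
  have : ∀ j : Fin (n + 1), ‖if j = 0 then w ω else 1‖ = if j = 0 then ‖w ω‖ else 1 := by
    intro j; split_ifs <;> simp
  simp only [absorbWeight, SNorm_const_mul, Finset.prod_mul_distrib, this, prod_ite_zero_eq]

lemma norm_prod_mul_jb_le (ha : ∀ j ω, MemS (β j) (a j ω)) (ω : Ω) (x : Fin (n + 1) → ℝ) :
    ‖w ω * ∏ j, (a j ω (x j) * ((jb (x j) ^ (-β j) : ℝ) : ℂ))‖ ≤
      ‖w ω‖ * ∏ j, SNorm (β j) 0 (a j ω) := by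
  rw [norm_mul, norm_prod]
  refine mul_le_mul_of_nonneg_left
    (Finset.prod_le_prod (fun _ _ => norm_nonneg _) fun j _ => ?_) (norm_nonneg _)
  rw [norm_mul, Complex.norm_real, Real.norm_of_nonneg (Real.rpow_nonneg (jb_pos _).le _)]
  exact (ha j ω).norm_mul_jb_le _

lemma mul_prod_eq_jb (ω : Ω) (x : Fin (n + 1) → ℝ) :
    w ω * ∏ j, a j ω (x j) =
      w ω * (∏ j, (a j ω (x j) * ((jb (x j) ^ (-β j) : ℝ) : ℂ))) *
        (∏ j, ((jb (x j) ^ β j : ℝ) : ℂ)) := by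
  rw [mul_assoc, ← Finset.prod_mul_distrib]
  congr 1
  refine Finset.prod_congr rfl fun j _ => ?_
  rw [mul_assoc, ← Complex.ofReal_mul, ← Real.rpow_add (jb_pos _)]
  simp

lemma summable_box (ha : ∀ j ω, MemS (β j) (a j ω))
    (hs : Summable fun ω => ‖w ω‖ * ∏ j, SNorm (β j) 0 (a j ω))
    (x : Fin (n + 1) → ℝ) : Summable fun ω => w ω * ∏ j, a j ω (x j) := by
  simp_rw [mul_prod_eq_jb (β := β)]
  exact (hs.of_norm_bounded fun ω => norm_prod_mul_jb_le ha ω x).mul_right _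

lemma continuous_box (ha : ∀ j ω, MemS (β j) (a j ω))
    (hs : Summable fun ω => ‖w ω‖ * ∏ j, SNorm (β j) 0 (a j ω)) :
    Continuous fun x : Fin (n + 1) → ℝ => ∑' ω, w ω * ∏ j, a j ω (x j) := by
  simp_rw [mul_prod_eq_jb (β := β), tsum_mul_right]
  have hc : ∀ r : ℝ, Continuous fun y : ℝ => ((jb y ^ r : ℝ) : ℂ) := fun r =>
    Complex.continuous_ofReal.comp
      (continuous_jb.rpow_const fun x => Or.inl (jb_pos x).ne')
  refine Continuous.mul ?_ ?_
  · refine continuous_tsum (fun ω => ?_) hs fun ω x => norm_prod_mul_jb_le ha ω x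
    refine continuous_const.mul (continuous_finsetProd _ fun j _ => ?_)
    exact ((ha j ω).1.continuous.comp (continuous_apply j)).mul
      ((hc _).comp (continuous_apply j))
  · exact continuous_finsetProd _ fun j _ => (hc _).comp (continuous_apply j)

lemma isBoxRep_of_summable [Countable Ω] (ha : ∀ j ω, MemS (β j) (a j ω))
    (hs : ∀ k : Fin (n + 1) → ℕ,
      Summable fun ω => ‖w ω‖ * ∏ j, SNorm (β j) (k j) (a j ω)) :
    IsBoxRep β (fun x => ∑' ω, w ω * ∏ j, a j ω (x j)) Ω ⊤ (@Measure.count Ω ⊤)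
      (absorbWeight w a) := by
  let _ : MeasurableSpace Ω := ⊤
  refine ⟨inferInstance, fun j => ?_, fun j ω => (ha j ω).const_mul _, fun j k =>
    measurable_from_top, fun x => ?_, fun k => ?_⟩
  · refine measurable_from_prod_countable_left fun ω => ?_
    exact ((ha j ω).const_mul (if j = 0 then w ω else 1)).1.continuous.measurable
  · have hint : Integrable (fun ω => ∏ j, absorbWeight w a j (x j) ω) Measure.count := by
      rw [integrable_count_iff]
      simp_rw [prod_absorbWeight]
      exact (summable_box ha (hs 0) x).norm
    rw [integral_countable hint]
    simp [prod_absorbWeight]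
  · rw [integrable_count_iff]
    simp_rw [prod_SNorm_absorbWeight]
    exact (hs k).norm

lemma boxNorm_le_tsum [Countable Ω] (ha : ∀ j ω, MemS (β j) (a j ω))
    (hs : ∀ k : Fin (n + 1) → ℕ,
      Summable fun ω => ‖w ω‖ * ∏ j, SNorm (β j) (k j) (a j ω)) (k : Fin (n + 1) → ℕ) :
    boxNorm β k (fun x => ∑' ω, w ω * ∏ j, a j ω (x j)) ≤
      ENNReal.ofReal (∑' ω, ‖w ω‖ * ∏ j, SNorm (β j) (k j) (a j ω)) := by
  let _ : MeasurableSpace Ω := ⊤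
  refine sInf_le ⟨Ω, ⊤, Measure.count, absorbWeight w a, isBoxRep_of_summable ha hs, ?_⟩
  have hn : ∀ ω, 0 ≤ ‖w ω‖ * ∏ j, SNorm (β j) (k j) (a j ω) := fun ω =>
    mul_nonneg (norm_nonneg _) (Finset.prod_nonneg fun j _ => SNorm_nonneg _ _ _)
  rw [lintegral_count, ENNReal.ofReal_tsum_of_nonneg hn (hs k)]
  refine tsum_congr fun ω => ?_
  rw [← prod_SNorm_absorbWeight, ENNReal.ofReal_prod_of_nonneg fun j _ => SNorm_nonneg _ _ _]

end BoxSum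

/-- The linear factor `x + i`, whose modulus is the Japanese bracket. -/
def shiftI (x : ℝ) : ℂ := x + Complex.I

/-- The resolvent factor `1 / (x + iτ)`. -/
noncomputable def res (τ x : ℝ) : ℂ := ((x : ℂ) + τ * Complex.I)⁻¹

/-- The Cayley transform `(x - iτ) / (x + iτ)`. -/
noncomputable def cayley (τ x : ℝ) : ℂ := ((x : ℂ) - τ * Complex.I) * res τ x

/-- The rational building blocks `(x + iτ)⁻¹ ((x - iτ) / (x + iτ)) ^ k`. -/
noncomputable def block (τ : ℝ) (k : ℕ) (x : ℝ) : ℂ := res τ x * cayley τ x ^ k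

lemma ofReal_add_mul_I_ne_zero {τ : ℝ} (hτ : τ ≠ 0) (x : ℝ) : (x : ℂ) + τ * Complex.I ≠ 0 := by
  intro h
  have := congrArg Complex.im h
  simp at this
  exact hτ this

lemma shiftI_ne_zero (x : ℝ) : shiftI x ≠ 0 := by
  simpa [shiftI] using ofReal_add_mul_I_ne_zero one_ne_zero x

lemma res_ne_zero {τ : ℝ} (hτ : τ ≠ 0) (x : ℝ) : res τ x ≠ 0 :=
  inv_ne_zero (ofReal_add_mul_I_ne_zero hτ x)

lemma norm_ofReal_add_mul_I (τ x : ℝ) : ‖(x : ℂ) + τ * Complex.I‖ = √(x ^ 2 + τ ^ 2) := by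
  rw [Complex.norm_add_mul_I]

lemma norm_shiftI (x : ℝ) : ‖shiftI x‖ = jb x := by
  have := norm_ofReal_add_mul_I 1 x
  rw [shiftI, jb, add_comm 1]
  simpa using this

lemma norm_cayley {τ : ℝ} (hτ : τ ≠ 0) (x : ℝ) : ‖cayley τ x‖ = 1 := by
  have h : ‖(x : ℂ) - τ * Complex.I‖ = ‖(x : ℂ) + τ * Complex.I‖ := by
    have := norm_ofReal_add_mul_I (-τ) x
    rw [norm_ofReal_add_mul_I]
    simpa [sub_eq_add_neg] using this
  rw [cayley, res, norm_mul, norm_inv, h, mul_inv_cancel₀]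
  exact norm_ne_zero_iff.2 (ofReal_add_mul_I_ne_zero hτ x)

lemma abs_mul_norm_res_le (τ x : ℝ) : |τ| * ‖res τ x‖ ≤ 1 := by
  rw [res, norm_inv, norm_ofReal_add_mul_I]
  refine mul_inv_le_one_of_le₀ (Real.abs_le_sqrt ?_) (Real.sqrt_nonneg _)
  nlinarith [sq_nonneg x]

lemma norm_res_mul_jb_le {τ : ℝ} (hτ : 1 ≤ |τ|) (x : ℝ) : ‖res τ x‖ * jb x ≤ 1 := by
  rw [res, norm_inv, norm_ofReal_add_mul_I, mul_comm, jb]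
  refine mul_inv_le_one_of_le₀ (Real.sqrt_le_sqrt ?_) (Real.sqrt_nonneg _)
  have := one_le_sq_iff_one_le_abs _ |>.2 hτ
  linarith

lemma hasDerivAt_shiftI (x : ℝ) : HasDerivAt shiftI 1 x :=
  (Complex.ofRealCLM.hasDerivAt (x := x)).add_const _

lemma hasDerivAt_res {τ : ℝ} (hτ : τ ≠ 0) (x : ℝ) : HasDerivAt (res τ) (-res τ x ^ 2) x := by
  have h : HasDerivAt (fun x : ℝ => (x : ℂ) + τ * Complex.I) 1 x :=
    (Complex.ofRealCLM.hasDerivAt (x := x)).add_const _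
  refine (h.fun_inv (ofReal_add_mul_I_ne_zero hτ x)).congr_deriv ?_
  unfold res
  field_simp

lemma hasDerivAt_cayley {τ : ℝ} (hτ : τ ≠ 0) (x : ℝ) :
    HasDerivAt (cayley τ) (2 * τ * Complex.I * res τ x ^ 2) x := by
  have h : HasDerivAt (fun x : ℝ => (x : ℂ) - τ * Complex.I) 1 x :=
    (Complex.ofRealCLM.hasDerivAt (x := x)).sub_const _
  refine (h.mul (hasDerivAt_res hτ x)).congr_deriv ?_
  have := ofReal_add_mul_I_ne_zero hτ x
  unfold res
  field_simp
  ring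

lemma contDiff_shiftI {m : WithTop ℕ∞} : ContDiff ℝ m shiftI :=
  Complex.ofRealCLM.contDiff.add contDiff_const

lemma contDiff_res {τ : ℝ} (hτ : τ ≠ 0) {m : WithTop ℕ∞} : ContDiff ℝ m (res τ) :=
  (Complex.ofRealCLM.contDiff.add contDiff_const).inv (ofReal_add_mul_I_ne_zero hτ)

lemma contDiff_cayley {τ : ℝ} (hτ : τ ≠ 0) {m : WithTop ℕ∞} : ContDiff ℝ m (cayley τ) :=
  (Complex.ofRealCLM.contDiff.sub contDiff_const).mul (contDiff_res hτ)

lemma contDiff_block {τ : ℝ} (hτ : τ ≠ 0) (k : ℕ) {m : WithTop ℕ∞} : ContDiff ℝ m (block τ k) :=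
  (contDiff_res hτ).mul ((contDiff_cayley hτ).pow k)

/-- A constant for the derivative bounds of `res τ ^ s * cayley τ ^ a`. -/
def blockConst : ℕ → ℕ → ℝ
  | 0, _ => 1
  | k + 1, s => s * blockConst k (s + 1) + 2 * blockConst k (s + 2)

lemma blockConst_nonneg (k s : ℕ) : 0 ≤ blockConst k s := by
  induction k generalizing s with
  | zero => exact zero_le_one
  | succ k ih =>
    have h1 := ih (s + 1)
    have h2 := ih (s + 2)
    rw [blockConst]
    positivity

lemma deriv_res_pow_mul_cayley_pow {τ : ℝ} (hτ : τ ≠ 0) (s a : ℕ) :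
    deriv (fun x => res τ x ^ s * cayley τ x ^ a) = fun x =>
      (-s : ℂ) * (res τ x ^ (s + 1) * cayley τ x ^ a) +
        (2 * τ * Complex.I * a) * (res τ x ^ (s + 2) * cayley τ x ^ (a - 1)) := by
  ext x
  rw [(((hasDerivAt_res hτ x).fun_pow s).fun_mul ((hasDerivAt_cayley hτ x).fun_pow a)).deriv]
  rcases s with _ | s
  · simp; ring
  · simp; ring

lemma norm_iteratedDeriv_res_pow_mul_cayley_pow_le {τ : ℝ} (hτ : τ ≠ 0) (k s a : ℕ) (x : ℝ) :
    ‖iteratedDeriv k (fun x => res τ x ^ s * cayley τ x ^ a) x‖ ≤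
      blockConst k s * (1 + a) ^ k * ‖res τ x‖ ^ (s + k) := by
  induction k generalizing s a with
  | zero => simp [blockConst, norm_cayley hτ]
  | succ k ih =>
    have hd : ∀ s a : ℕ, ContDiff ℝ k (fun x => res τ x ^ s * cayley τ x ^ a) := fun s a =>
      ((contDiff_res hτ).pow s).mul ((contDiff_cayley hτ).pow a)
    rw [iteratedDeriv_succ', deriv_res_pow_mul_cayley_pow hτ, iteratedDeriv_fun_add
      (contDiff_const.mul (hd _ _)).contDiffAt (contDiff_const.mul (hd _ _)).contDiffAt,
      iteratedDeriv_const_mul_field, iteratedDeriv_const_mul_field]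
    refine (norm_add_le _ _).trans ?_
    rw [norm_mul, norm_mul]
    have h1 := ih (s + 1) a
    have h2 := ih (s + 2) (a - 1)
    have e1 : ‖(-s : ℂ)‖ = s := by simp
    have e2 : ‖(2 * τ * Complex.I * a : ℂ)‖ = 2 * |τ| * a := by simp
    have hr := norm_nonneg (res τ x)
    have c1 := blockConst_nonneg k (s + 1)
    have c2 := blockConst_nonneg k (s + 2)
    have ha : (0 : ℝ) ≤ a := a.cast_nonneg
    have hpow : ((1 : ℝ) + (a - 1 : ℕ)) ^ k ≤ (1 + a) ^ k := by
      gcongr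
      omega
    rw [e1, e2, blockConst]
    calc _ ≤ s * (blockConst k (s + 1) * (1 + a) ^ k * ‖res τ x‖ ^ (s + 1 + k)) +
          2 * |τ| * a * (blockConst k (s + 2) * (1 + a) ^ k * ‖res τ x‖ ^ (s + 2 + k)) := by
            gcongr
            exact h2.trans (by gcongr)
      _ = (s * blockConst k (s + 1) * 1 + 2 * blockConst k (s + 2) * (|τ| * ‖res τ x‖) * a) *
          (1 + a) ^ k * ‖res τ x‖ ^ (s + (k + 1)) := by ring
      _ ≤ (s * blockConst k (s + 1) * (1 + a) + 2 * blockConst k (s + 2) * 1 * (1 + a)) *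
          (1 + a) ^ k * ‖res τ x‖ ^ (s + (k + 1)) := by
            gcongr
            · linarith
            · exact abs_mul_norm_res_le τ x
            · linarith
      _ = _ := by ring

lemma sWeight_block_le {τ : ℝ} (hτ : 1 ≤ |τ|) {β : ℝ} (h1 : -1 ≤ β) (h0 : β ≤ 0) (k a : ℕ)
    (x : ℝ) : sWeight β k (block τ a) x ≤ blockConst k 1 * (1 + a) ^ k * |τ| ^ (-1 - β) := by
  have hτ0 : τ ≠ 0 := by rintro rfl; norm_num at hτ
  have h := norm_iteratedDeriv_res_pow_mul_cayley_pow_le hτ0 k 1 a x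
  simp only [pow_one] at h
  have hτp : 0 < |τ| := by linarith
  have hr : 0 < ‖res τ x‖ := norm_pos_iff.2 (res_ne_zero hτ0 x)
  have hj := jb_pos x
  have hc := blockConst_nonneg k 1
  have hsplit : ‖res τ x‖ ^ (1 + k) * jb x ^ ((k : ℝ) - β) =
      ‖res τ x‖ ^ (1 + β) * (‖res τ x‖ * jb x) ^ ((k : ℝ) - β) := by
    rw [Real.mul_rpow hr.le hj.le, ← mul_assoc, ← Real.rpow_add hr, ← Real.rpow_natCast]
    congr 2
    push_cast
    ring
  have hb1 : (‖res τ x‖ * jb x) ^ ((k : ℝ) - β) ≤ 1 :=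
    Real.rpow_le_one (by positivity) (norm_res_mul_jb_le hτ x)
      (by linarith [k.cast_nonneg (α := ℝ)])
  have hb2 : ‖res τ x‖ ^ (1 + β) ≤ |τ| ^ (-1 - β) := by
    have : ‖res τ x‖ ≤ |τ|⁻¹ := by
      rw [← one_div, le_div_iff₀ hτp, mul_comm]
      exact abs_mul_norm_res_le τ x
    calc _ ≤ (|τ|⁻¹) ^ (1 + β) := Real.rpow_le_rpow hr.le this (by linarith)
      _ = _ := by
        rw [Real.inv_rpow hτp.le, ← Real.rpow_neg hτp.le]
        congr 1
        ring
  calc sWeight β k (block τ a) x ≤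
      blockConst k 1 * (1 + a) ^ k * ‖res τ x‖ ^ (1 + k) * jb x ^ ((k : ℝ) - β) :=
        mul_le_mul_of_nonneg_right h (Real.rpow_nonneg hj.le _)
    _ = blockConst k 1 * (1 + a) ^ k *
        (‖res τ x‖ ^ (1 + β) * (‖res τ x‖ * jb x) ^ ((k : ℝ) - β)) := by
          rw [mul_assoc, hsplit]
    _ ≤ blockConst k 1 * (1 + a) ^ k * (|τ| ^ (-1 - β) * 1) := by gcongr
    _ = _ := by ring

lemma norm_iteratedDeriv_mul_le {f g : ℝ → ℂ} (hf : ContDiff ℝ (⊤ : ℕ∞) f)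
    (hg : ContDiff ℝ (⊤ : ℕ∞) g) (k : ℕ) (x : ℝ) :
    ‖iteratedDeriv k (fun y => f y * g y) x‖ ≤ ∑ i ∈ Finset.range (k + 1),
      (k.choose i : ℝ) * ‖iteratedDeriv i f x‖ * ‖iteratedDeriv (k - i) g x‖ := by
  have hk : ((k : ℕ∞) : WithTop ℕ∞) ≤ ((⊤ : ℕ∞) : WithTop ℕ∞) := by exact_mod_cast le_top
  rw [iteratedDeriv_fun_mul (hf.of_le hk).contDiffAt (hg.of_le hk).contDiffAt]
  refine (norm_sum_le _ _).trans (Finset.sum_le_sum fun i _ => ?_)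
  simp

lemma sWeight_mul_le {f g : ℝ → ℂ} (hf : ContDiff ℝ (⊤ : ℕ∞) f) (hg : ContDiff ℝ (⊤ : ℕ∞) g)
    (β β' : ℝ) (k : ℕ) (x : ℝ) :
    sWeight (β + β') k (fun y => f y * g y) x ≤ ∑ i ∈ Finset.range (k + 1),
      (k.choose i : ℝ) * sWeight β i f x * sWeight β' (k - i) g x := by
  have hj := jb_pos x
  refine (mul_le_mul_of_nonneg_right (norm_iteratedDeriv_mul_le hf hg k x)
    (Real.rpow_nonneg hj.le _)).trans_eq ?_
  rw [Finset.sum_mul]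
  refine Finset.sum_congr rfl fun i hi => ?_
  have hik : i ≤ k := by simpa [Nat.lt_succ_iff] using hi
  have : jb x ^ ((k : ℝ) - (β + β')) = jb x ^ ((i : ℝ) - β) * jb x ^ (((k - i : ℕ) : ℝ) - β') := by
    rw [← Real.rpow_add hj]
    congr 1
    push_cast [hik]
    ring
  rw [this, sWeight, sWeight]
  ring

/-- A constant for the derivative bounds of `shiftI ^ z`. -/
def zpowConst : ℕ → ℤ → ℝ
  | 0, _ => 1
  | k + 1, z => |(z : ℝ)| * zpowConst k (z - 1)

lemma zpowConst_nonneg (k : ℕ) (z : ℤ) : 0 ≤ zpowConst k z := by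
  induction k generalizing z with
  | zero => exact zero_le_one
  | succ k ih => exact mul_nonneg (abs_nonneg _) (ih _)

lemma deriv_shiftI_zpow (z : ℤ) :
    deriv (fun x => shiftI x ^ z) = fun x => (z : ℂ) * shiftI x ^ (z - 1) := by
  ext x
  have := (hasDerivAt_zpow z (shiftI x) (Or.inl (shiftI_ne_zero x))).comp_of_eq x
    (hasDerivAt_shiftI x) rfl
  exact this.deriv.trans (by simp)

lemma contDiff_shiftI_zpow (z : ℤ) : ContDiff ℝ (⊤ : ℕ∞) (fun x => shiftI x ^ z) := by
  rcases z with b | b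
  · simpa using contDiff_shiftI.pow b
  · simp only [zpow_negSucc]
    exact (contDiff_shiftI.pow _).inv fun x => pow_ne_zero _ (shiftI_ne_zero x)

lemma sWeight_shiftI_zpow_le (z : ℤ) (k : ℕ) (x : ℝ) :
    sWeight z k (fun x => shiftI x ^ z) x ≤ zpowConst k z := by
  have key : ∀ (k : ℕ) (z : ℤ),
      ‖iteratedDeriv k (fun x => shiftI x ^ z) x‖ ≤ zpowConst k z * jb x ^ (z - k) := by
    intro k
    induction k with
    | zero => simp [zpowConst, norm_zpow, norm_shiftI]
    | succ k ih =>
      intro z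
      rw [iteratedDeriv_succ', deriv_shiftI_zpow, iteratedDeriv_const_mul_field, norm_mul,
        zpowConst, mul_assoc]
      have := ih (z - 1)
      rw [show z - 1 - (k : ℤ) = z - ((k + 1 : ℕ) : ℤ) by push_cast; ring] at this
      simpa using mul_le_mul_of_nonneg_left this (norm_nonneg (z : ℂ))
  have hj := jb_pos x
  refine (mul_le_mul_of_nonneg_right (key k z) (Real.rpow_nonneg hj.le _)).trans_eq ?_
  rw [← Real.rpow_intCast, mul_assoc, ← Real.rpow_add hj]
  simp

lemma memS_and_SNorm_le {β : ℝ} {f : ℝ → ℂ} {B : ℕ → ℝ} (hf : ContDiff ℝ (⊤ : ℕ∞) f)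
    (h : ∀ k x, sWeight β k f x ≤ B k) : MemS β f ∧ ∀ k, SNorm β k f ≤ B k :=
  ⟨⟨hf, fun k => ⟨B k, by rintro _ ⟨x, rfl⟩; exact h k x⟩⟩, fun k => ciSup_le (h k)⟩

lemma memS_shiftI_pow (b : ℕ) : MemS b (fun x => shiftI x ^ b) ∧
    ∀ k, SNorm b k (fun x => shiftI x ^ b) ≤ zpowConst k b := by
  refine memS_and_SNorm_le (contDiff_shiftI.pow b) fun k x => ?_
  simpa using sWeight_shiftI_zpow_le b k x

/-- A constant for the seminorms of `shiftI ^ b * block τ a`. -/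
def shiftBlockConst (b k : ℕ) : ℝ :=
  ∑ i ∈ Finset.range (k + 1), (k.choose i : ℝ) * zpowConst i b * blockConst (k - i) 1

lemma memS_shiftI_pow_mul_block {τ : ℝ} (hτ : 1 ≤ |τ|) {β : ℝ} (h1 : -1 ≤ β) (h0 : β ≤ 0)
    (b a : ℕ) : MemS (b + β) (fun x => shiftI x ^ b * block τ a x) ∧
      ∀ k, SNorm (b + β) k (fun x => shiftI x ^ b * block τ a x) ≤
        shiftBlockConst b k * (1 + a) ^ k * |τ| ^ (-1 - β) := by
  have hτ0 : τ ≠ 0 := by rintro rfl; norm_num at hτ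
  refine memS_and_SNorm_le ((contDiff_shiftI.pow b).mul (contDiff_block hτ0 a)) fun k x => ?_
  refine (sWeight_mul_le (contDiff_shiftI.pow b) (contDiff_block hτ0 a) b β k x).trans ?_
  rw [shiftBlockConst, Finset.sum_mul, Finset.sum_mul]
  refine Finset.sum_le_sum fun i hi => ?_
  have hz : sWeight b i (fun x => shiftI x ^ b) x ≤ zpowConst i b := by
    simpa using sWeight_shiftI_zpow_le b i x
  have hz0 := zpowConst_nonneg i b
  have hb0 := blockConst_nonneg (k - i) 1
  have hs0 := sWeight_nonneg β (k - i) (block τ a) x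
  have ht : 0 ≤ |τ| ^ (-1 - β) := by positivity
  calc _ ≤ (k.choose i : ℝ) * zpowConst i b *
        (blockConst (k - i) 1 * (1 + a) ^ (k - i) * |τ| ^ (-1 - β)) := by
          gcongr
          exact sWeight_block_le hτ h1 h0 _ _ _
    _ ≤ (k.choose i : ℝ) * zpowConst i b *
        (blockConst (k - i) 1 * (1 + a) ^ k * |τ| ^ (-1 - β)) := by
          gcongr
          · simp
          · exact Nat.sub_le k i
    _ = _ := by ring

lemma tWeight_eq_sWeight_div (β : ℝ) (k : ℕ) (f : ℝ → ℂ) (x : ℝ) :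
    tWeight β k f x = sWeight β k f x * (jb x)⁻¹ := by
  rw [tWeight, sWeight, Real.rpow_sub_one (jb_pos x).ne', div_eq_mul_inv, mul_assoc]

lemma tWeight_nonneg (β : ℝ) (k : ℕ) (f : ℝ → ℂ) (x : ℝ) : 0 ≤ tWeight β k f x :=
  mul_nonneg (norm_nonneg _) (Real.rpow_nonneg (jb_pos x).le _)

lemma TNorm_nonneg (β : ℝ) (k : ℕ) (f : ℝ → ℂ) : 0 ≤ TNorm β k f :=
  integral_nonneg (tWeight_nonneg β k f)

lemma continuous_tWeight {f : ℝ → ℂ} (hf : ContDiff ℝ (⊤ : ℕ∞) f) (β : ℝ) (k : ℕ) :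
    Continuous (tWeight β k f) := by
  have hk : ((k : ℕ∞) : WithTop ℕ∞) ≤ ((⊤ : ℕ∞) : WithTop ℕ∞) := by exact_mod_cast le_top
  exact (hf.continuous_iteratedDeriv k hk).norm.mul
    (continuous_jb.rpow_const fun x => Or.inl (jb_pos x).ne')

/-- Multiplication by `shiftI ^ z` maps `T^β` to `T^(β + z)`. -/
lemma MemT.shiftI_zpow_mul {β : ℝ} {f : ℝ → ℂ} (hf : MemT β f) (z : ℤ) :
    MemT (z + β) (fun x => shiftI x ^ z * f x) ∧
      ∀ k, TNorm (z + β) k (fun x => shiftI x ^ z * f x) ≤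
        (∑ i ∈ Finset.range (k + 1), (k.choose i : ℝ) * zpowConst i z) *
          ∑ r ∈ Finset.range (k + 1), TNorm β r f := by
  have hc : ContDiff ℝ (⊤ : ℕ∞) (fun x => shiftI x ^ z * f x) := (contDiff_shiftI_zpow z).mul hf.1
  have hpt : ∀ k x, tWeight (z + β) k (fun x => shiftI x ^ z * f x) x ≤
      ∑ i ∈ Finset.range (k + 1), (k.choose i : ℝ) * zpowConst i z * tWeight β (k - i) f x := by
    intro k x
    rw [tWeight_eq_sWeight_div]
    refine (mul_le_mul_of_nonneg_right (sWeight_mul_le (contDiff_shiftI_zpow z) hf.1 z β k x)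
      (inv_nonneg.2 (jb_pos x).le)).trans ?_
    rw [Finset.sum_mul]
    refine Finset.sum_le_sum fun i _ => ?_
    rw [mul_assoc, ← tWeight_eq_sWeight_div]
    have := sWeight_shiftI_zpow_le z i x
    have := tWeight_nonneg β (k - i) f x
    gcongr
  have hint : ∀ k, Integrable fun x =>
      ∑ i ∈ Finset.range (k + 1), (k.choose i : ℝ) * zpowConst i z * tWeight β (k - i) f x :=
    fun k => integrable_finsetSum _ fun i _ => (hf.2 (k - i)).const_mul _
  have hI : ∀ k, Integrable (tWeight (z + β) k (fun x => shiftI x ^ z * f x)) := fun k =>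
    (hint k).mono' (continuous_tWeight hc _ _).aestronglyMeasurable
      (Filter.Eventually.of_forall fun x => by
        rw [Real.norm_of_nonneg (tWeight_nonneg _ _ _ _)]
        exact hpt k x)
  refine ⟨⟨hc, hI⟩, fun k => (integral_mono (hI k) (hint k) (hpt k)).trans ?_⟩
  rw [integral_finsetSum _ fun i _ => (hf.2 (k - i)).const_mul _, Finset.sum_mul]
  refine Finset.sum_le_sum fun i _ => ?_
  rw [integral_const_mul]
  refine mul_le_mul_of_nonneg_left ?_ (mul_nonneg (Nat.cast_nonneg _) (zpowConst_nonneg _ _))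
  exact Finset.single_le_sum (f := fun r => TNorm β r f) (fun r _ => TNorm_nonneg β r f)
    (Finset.mem_range.2 (by omega))

section Series

open PowerSeries

lemma sub_eq_of_mul_eq_one {A : Type*} [CommRing A] {p q r s : A} (hp : p * r = 1)
    (hq : q * s = 1) : s - r = (p - q) * r * s := by
  linear_combination (-s) * hp + r * hq

lemma mk_block_mul {τ : ℝ} (hτ : τ ≠ 0) (x : ℝ) :
    (C ((x : ℂ) + τ * Complex.I) - C ((x : ℂ) - τ * Complex.I) * X) *
      mk (fun k => block τ k x) = 1 := by
  have h0 := ofReal_add_mul_I_ne_zero hτ x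
  ext k
  rw [sub_mul, mul_assoc, map_sub, coeff_C_mul, coeff_C_mul]
  rcases k with _ | k
  · simp [block, res, h0]
  · rw [coeff_succ_X_mul, coeff_mk, coeff_mk, coeff_one, if_neg k.succ_ne_zero, block, block,
      pow_succ, cayley, res]
    field_simp
    ring

lemma divDiff_block {τ : ℝ} (hτ : τ ≠ 0) {z : ℕ → ℝ} (k a n : ℕ)
    (hz : Set.InjOn z (Set.Icc a (a + n))) :
    divDiff (block τ k) z a n = coeff k ((1 - X) ^ n *
      ∏ i ∈ Finset.range (n + 1), mk (fun k => block τ k (z (a + i)))) := by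
  rw [← divDiff_coeff (R := fun x => mk (fun k => block τ k x)) (fun x y => ?_) k a n hz]
  · simp
  · rw [sub_eq_of_mul_eq_one (mk_block_mul hτ x) (mk_block_mul hτ y)]
    simp only [map_add, map_sub, map_mul, Complex.ofReal_sub]
    ring

lemma mk_shiftI_pow_mul (x : ℝ) : (1 - C (shiftI x) * X) * mk (fun k => shiftI x ^ k) = 1 := by
  ext k
  rw [sub_mul, mul_assoc, map_sub, one_mul, coeff_C_mul]
  rcases k with _ | k
  · simp
  · rw [coeff_succ_X_mul, coeff_mk, coeff_mk, coeff_one, if_neg k.succ_ne_zero, pow_succ]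
    ring

lemma coeff_prod_mk {m : ℕ} (E : Fin m → ℕ → ℂ) (s : Finset (Fin m)) (K : ℕ) :
    coeff K (∏ i ∈ s, mk (E i)) = ∑ a ∈ Finset.piAntidiag s K, ∏ i ∈ s, E i (a i) := by
  rw [coeff_prod]
  refine Finset.sum_bij (fun a _ => (a : Fin m → ℕ)) (fun a ha => ?_)
    (fun a _ b _ h => DFunLike.coe_injective h) (fun b hb => ?_) fun a _ => by simp
  · rw [Finset.mem_finsuppAntidiag] at ha
    exact Finset.mem_piAntidiag.2 ⟨ha.1, fun i hi => ha.2 (Finsupp.mem_support_iff.2 hi)⟩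
  · rw [Finset.mem_piAntidiag] at hb
    refine ⟨Finsupp.equivFunOnFinite.symm b, ?_, by simp⟩
    rw [Finset.mem_finsuppAntidiag]
    exact ⟨by simpa using hb.1, fun i hi => hb.2 i (by simpa using hi)⟩

lemma divDiff_shiftI_pow {z : ℕ → ℝ} {p j : ℕ} (hj : j ≤ p)
    (hz : Set.InjOn z (Set.Icc 0 (0 + j))) :
    divDiff (fun x => shiftI x ^ p) z 0 j = (-1) ^ j *
      coeff (p - j) (∏ i ∈ Finset.range (j + 1), mk (fun k => shiftI (z i) ^ k)) := by
  have h := divDiff_coeff (R := fun x => mk (fun k => shiftI x ^ k)) (E := -X)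
    (fun x y => ?_) p 0 j hz
  · simp only [coeff_mk, zero_add] at h
    rw [h, neg_pow, mul_assoc, ← map_one (C (R := ℂ)), ← map_neg, ← map_pow, coeff_C_mul]
    congr 1
    conv_lhs => rw [← Nat.sub_add_cancel hj]
    exact coeff_X_pow_mul _ _ _
  · rw [sub_eq_of_mul_eq_one (mk_shiftI_pow_mul x) (mk_shiftI_pow_mul y)]
    simp only [shiftI, map_add, map_sub, Complex.ofReal_sub]
    ring

/-- Polynomial growth of the coefficients of a power series. -/
def PolyGrowth (Q : PowerSeries ℂ) : Prop :=
  ∃ (B : ℝ) (M : ℕ), ∀ k, ‖coeff k Q‖ ≤ B * (1 + k) ^ M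

lemma polyGrowth_of_le {Q : PowerSeries ℂ} {B : ℝ} (h : ∀ k, ‖coeff k Q‖ ≤ B) :
    PolyGrowth Q := ⟨B, 0, by simpa using h⟩

lemma PolyGrowth.mul {P Q : PowerSeries ℂ} (hP : PolyGrowth P) (hQ : PolyGrowth Q) :
    PolyGrowth (P * Q) := by
  obtain ⟨B, M, hB⟩ := hP
  obtain ⟨B', M', hB'⟩ := hQ
  have hB0 : 0 ≤ B := by simpa using (norm_nonneg _).trans (hB 0)
  have hB0' : 0 ≤ B' := by simpa using (norm_nonneg _).trans (hB' 0)
  refine ⟨B * B', M + M' + 1, fun k => ?_⟩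
  rw [coeff_mul]
  refine (norm_sum_le_of_le (f := fun q : ℕ × ℕ => coeff q.1 P * coeff q.2 Q)
    (n := fun _ => B * B' * (1 + k) ^ (M + M')) _ fun q hq => ?_).trans_eq ?_
  · have hq' := Finset.HasAntidiagonal.mem_antidiagonal.1 hq
    rw [norm_mul]
    have h1 : (q.1 : ℝ) ≤ k := by exact_mod_cast (by omega : q.1 ≤ k)
    have h2 : (q.2 : ℝ) ≤ k := by exact_mod_cast (by omega : q.2 ≤ k)
    calc _ ≤ (B * (1 + q.1) ^ M) * (B' * (1 + q.2) ^ M') := by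
          gcongr
          · exact hB _
          · exact hB' _
      _ ≤ (B * (1 + k) ^ M) * (B' * (1 + k) ^ M') := by gcongr
      _ = _ := by ring
  · simp
    ring

lemma polyGrowth_one : PolyGrowth 1 :=
  polyGrowth_of_le (B := 1) fun k => by rw [coeff_one]; split_ifs <;> simp

lemma PolyGrowth.pow {Q : PowerSeries ℂ} (hQ : PolyGrowth Q) (d : ℕ) : PolyGrowth (Q ^ d) := by
  induction d with
  | zero => simpa using polyGrowth_one
  | succ d ih => rw [pow_succ]; exact ih.mul hQ

lemma polyGrowth_one_sub_X : PolyGrowth (1 - X) := by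
  refine polyGrowth_of_le (B := 2) fun k => ?_
  rw [map_sub, coeff_one, coeff_X]
  split_ifs <;> simp

/-- The difference operator adjoint to multiplication by `1 - X`. -/
def abelDiff (c : ℕ → ℂ) (k : ℕ) : ℂ := c k - c (k + 1)

/-- Rapid decay of a sequence, with explicit constants. -/
def RapidDecay (A : ℕ → ℝ) (c : ℕ → ℂ) : Prop := ∀ N k : ℕ, ‖c k‖ * (1 + k) ^ N ≤ A N

lemma RapidDecay.succ {A : ℕ → ℝ} {c : ℕ → ℂ} (hc : RapidDecay A c) :
    RapidDecay A fun k => c (k + 1) := fun N k => by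
  refine le_trans ?_ (hc N (k + 1))
  gcongr
  simp

lemma RapidDecay.diff {A : ℕ → ℝ} {c : ℕ → ℂ} (hc : RapidDecay A c) :
    RapidDecay (fun N => 2 * A N) (abelDiff c) := fun N k => by
  have h1 := hc N k
  have h2 := hc.succ N k
  calc ‖abelDiff c k‖ * (1 + k) ^ N ≤ (‖c k‖ + ‖c (k + 1)‖) * (1 + k) ^ N := by
        gcongr
        exact norm_sub_le _ _
    _ ≤ _ := by linarith

lemma RapidDecay.iterate_abelDiff {A : ℕ → ℝ} {c : ℕ → ℂ} (hc : RapidDecay A c) (d : ℕ) :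
    RapidDecay (fun N => 2 ^ d * A N) (abelDiff^[d] c) := by
  induction d with
  | zero => simpa using hc
  | succ d ih =>
    rw [Function.iterate_succ_apply']
    convert ih.diff using 2
    ring

lemma RapidDecay.summable_mul_coeff {A : ℕ → ℝ} {c : ℕ → ℂ} (hc : RapidDecay A c)
    {Q : PowerSeries ℂ} (hQ : PolyGrowth Q) : Summable fun k => c k * coeff k Q := by
  obtain ⟨B, M, hB⟩ := hQ
  have hB0 : 0 ≤ B := by simpa using (norm_nonneg _).trans (hB 0)
  have hs : Summable fun k : ℕ => B * A (M + 2) * (((k + 1 : ℕ) : ℝ) ^ 2)⁻¹ :=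
    (((summable_nat_add_iff 1).2 (Real.summable_nat_pow_inv.2 one_lt_two))).mul_left _
  refine hs.of_norm_bounded fun k => ?_
  have hk : (0 : ℝ) < 1 + k := by positivity
  rw [norm_mul, ← div_eq_mul_inv, le_div_iff₀ (by positivity)]
  calc _ ≤ ‖c k‖ * (B * (1 + k) ^ M) * ((k + 1 : ℕ) : ℝ) ^ 2 := by
        gcongr
        exact hB k
    _ = B * (‖c k‖ * (1 + k) ^ (M + 2)) := by
        push_cast
        ring
    _ ≤ _ := mul_le_mul_of_nonneg_left (hc _ _) hB0

lemma RapidDecay.tsum_one_sub_X_mul {A : ℕ → ℝ} {c : ℕ → ℂ} (hc : RapidDecay A c)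
    {Q : PowerSeries ℂ} (hQ : PolyGrowth Q) :
    ∑' k, c k * coeff k ((1 - X) * Q) = ∑' k, abelDiff c k * coeff k Q := by
  have h1 := hc.summable_mul_coeff hQ
  have h2 := hc.succ.summable_mul_coeff hQ
  have h3 : Summable fun k => c k * coeff k (X * Q) := by
    refine (summable_nat_add_iff 1).1 ?_
    simpa only [coeff_succ_X_mul] using h2
  simp only [sub_mul, one_mul, map_sub, mul_sub, abelDiff]
  rw [h1.tsum_sub h3, h1.tsum_sub h2, h3.tsum_eq_zero_add]
  simp [coeff_succ_X_mul]

lemma RapidDecay.tsum_one_sub_X_pow_mul {A : ℕ → ℝ} {c : ℕ → ℂ} (hc : RapidDecay A c)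
    {Q : PowerSeries ℂ} (hQ : PolyGrowth Q) (d : ℕ) :
    ∑' k, c k * coeff k ((1 - X) ^ d * Q) = ∑' k, (abelDiff^[d] c) k * coeff k Q := by
  induction d generalizing c A with
  | zero => simp
  | succ d ih =>
    rw [pow_succ', mul_assoc, hc.tsum_one_sub_X_mul ((polyGrowth_one_sub_X.pow d).mul hQ),
      ih hc.diff, Function.iterate_succ_apply]

end Series

lemma summable_pi_prod {m : ℕ} {f : ℕ → ℝ} (h0 : ∀ k, 0 ≤ f k) (hf : Summable f) :
    Summable fun a : Fin m → ℕ => ∏ i, f (a i) := by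
  classical
  refine summable_of_sum_le (c := ∏ _i : Fin m, ∑' k, f k)
    (fun a => Finset.prod_nonneg fun i _ => h0 _) fun u => ?_
  have hu : u ⊆ Fintype.piFinset fun i => u.image fun a => a i := fun a ha =>
    Fintype.mem_piFinset.2 fun i => Finset.mem_image_of_mem _ ha
  refine (Finset.sum_le_sum_of_subset_of_nonneg hu fun a _ _ =>
    Finset.prod_nonneg fun i _ => h0 _).trans ?_
  rw [← Finset.prod_univ_sum]
  exact Finset.prod_le_prod (fun i _ => Finset.sum_nonneg fun k _ => h0 k)
    fun i _ => hf.sum_le_tsum _ fun k _ => h0 k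

lemma summable_inv_one_add_sum_pow (n : ℕ) :
    Summable fun a : Fin (n + 1) → ℕ => (((1 : ℝ) + (∑ i, a i : ℕ)) ^ (n + 2))⁻¹ := by
  set θ : ℝ := ((n + 2 : ℕ) : ℝ) / (n + 1 : ℕ) with hθ
  have hθ1 : 1 < θ := by
    rw [hθ, one_lt_div (by positivity)]
    exact_mod_cast Nat.lt_succ_self _
  have hs : Summable fun k : ℕ => (((k + 1 : ℕ) : ℝ) ^ θ)⁻¹ :=
    (summable_nat_add_iff 1).2 (Real.summable_nat_rpow_inv.2 hθ1)
  refine (summable_pi_prod (m := n + 1) (fun k => by positivity) hs).of_nonneg_of_le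
    (fun a => by positivity) fun a => ?_
  rw [Finset.prod_inv_distrib]
  refine inv_anti₀ (Finset.prod_pos fun i _ => by positivity) ?_
  calc ∏ i, ((a i + 1 : ℕ) : ℝ) ^ θ ≤ ∏ _i : Fin (n + 1), ((1 : ℝ) + (∑ i, a i : ℕ)) ^ θ := by
        refine Finset.prod_le_prod (fun i _ => by positivity) fun i _ => ?_
        have : a i ≤ ∑ i, a i := Finset.single_le_sum (fun _ _ => Nat.zero_le _) (Finset.mem_univ i)
        gcongr
        exact_mod_cast (by omega : a i + 1 ≤ 1 + ∑ i, a i)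
    _ = _ := by
        rw [Finset.prod_const, Finset.card_univ, Fintype.card_fin, ← Real.rpow_mul_natCast
          (by positivity), hθ, div_mul_cancel₀ _ (by positivity), Real.rpow_natCast]

lemma RapidDecay.hasSum_blocks {n : ℕ} {A : ℕ → ℝ} {c : ℕ → ℂ} (hc : RapidDecay A c)
    {E : Fin (n + 1) → ℕ → ℂ} (hE : ∀ i k, ‖E i k‖ ≤ 1) (s : Finset (Fin (n + 1))) (d : ℕ) :
    HasSum (fun a : Fin (n + 1) → ℕ => if ∀ i, a i ≠ 0 → i ∈ s then
        (abelDiff^[d] c) (∑ i, a i) * ∏ i ∈ s, E i (a i) else 0)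
      (∑' k, c k * PowerSeries.coeff k ((1 - PowerSeries.X) ^ d *
        ∏ i ∈ s, PowerSeries.mk (E i))) := by
  classical
  have hd := hc.iterate_abelDiff d
  have hQ : PolyGrowth (∏ i ∈ s, PowerSeries.mk (E i)) :=
    Finset.prod_induction _ PolyGrowth (fun _ _ h h' => h.mul h') polyGrowth_one fun i _ =>
      polyGrowth_of_le (by simpa using hE i)
  rw [hc.tsum_one_sub_X_pow_mul hQ]
  set G : (Fin (n + 1) → ℕ) → ℂ := fun a => if ∀ i, a i ≠ 0 → i ∈ s then
        (abelDiff^[d] c) (∑ i, a i) * ∏ i ∈ s, E i (a i) else 0 with hG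
  have hsum : Summable G := by
    refine ((summable_inv_one_add_sum_pow n).mul_left (2 ^ d * A (n + 2))).of_norm_bounded
      fun a => ?_
    have hA := (hd (n + 2) (∑ i, a i))
    have hA' := (le_trans (by positivity) hA : 0 ≤ 2 ^ d * A (n + 2))
    have hE' : ‖∏ i ∈ s, E i (a i)‖ ≤ 1 := by
      rw [norm_prod]
      exact Finset.prod_le_one (fun _ _ => norm_nonneg _) fun i _ => hE i _
    rw [hG]
    dsimp only
    split_ifs
    · rw [norm_mul, ← div_eq_mul_inv, le_div_iff₀ (by positivity)]
      refine le_trans ?_ hA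
      gcongr
      exact mul_le_of_le_one_right (norm_nonneg _) hE'
    · rw [norm_zero]
      positivity
  have hfib := hsum.hasSum.tsum_fiberwise (fun a => ∑ i, a i)
  have : ∀ K, ∑' a : (fun a : Fin (n + 1) → ℕ => ∑ i, a i) ⁻¹' {K}, G a =
      (abelDiff^[d] c) K * PowerSeries.coeff K (∏ i ∈ s, PowerSeries.mk (E i)) := by
    intro K
    rw [coeff_prod_mk, Finset.mul_sum, tsum_subtype _ G, tsum_eq_sum (s := Finset.piAntidiag s K)]
    · refine Finset.sum_congr rfl fun a ha => ?_
      rw [Finset.mem_piAntidiag] at ha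
      have hK : ∑ i, a i = K := by
        rw [← ha.1]
        exact (Finset.sum_subset (Finset.subset_univ s) fun i _ hi =>
          by_contra fun h => hi (ha.2 i h)).symm
      rw [Set.indicator_of_mem (by exact hK), hG]
      dsimp only
      rw [if_pos ha.2, hK]
    · intro a ha
      rw [Set.indicator_apply]
      split_ifs with hK
      · rw [hG]
        dsimp only
        refine if_neg fun h => ha (Finset.mem_piAntidiag.2 ⟨?_, h⟩)
        refine Eq.trans ?_ (hK : ∑ i, a i = K)
        exact Finset.sum_subset (Finset.subset_univ s) fun i _ hi =>
          by_contra fun h' => hi (h i h')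
      · rfl
  simp only [this] at hfib
  rw [hfib.tsum_eq]
  exact hsum.hasSum

/-- The derivation `(1 + y²) d/dy`, which is `d/dφ` in the coordinate `y = tan φ`. -/
noncomputable def cayleyDeriv (q : ℝ → ℂ) (y : ℝ) : ℂ := ((1 + y ^ 2 : ℝ) : ℂ) * deriv q y

/-- The function `q ∘ tan` on `(-π/2, π/2)`, extended by zero. -/
noncomputable def tanLift (q : ℝ → ℂ) (φ : ℝ) : ℂ :=
  if |φ| < Real.pi / 2 then q (Real.tan φ) else 0

lemma contDiff_deriv_top {q : ℝ → ℂ} (hq : ContDiff ℝ (⊤ : ℕ∞) q) :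
    ContDiff ℝ (⊤ : ℕ∞) (deriv q) :=
  (contDiff_infty_iff_deriv.1 hq).2

lemma contDiff_cayleyDeriv {q : ℝ → ℂ} (hq : ContDiff ℝ (⊤ : ℕ∞) q) :
    ContDiff ℝ (⊤ : ℕ∞) (cayleyDeriv q) :=
  (Complex.ofRealCLM.contDiff.comp (by fun_prop : ContDiff ℝ (⊤ : ℕ∞) fun y : ℝ => 1 + y ^ 2)).mul
    (contDiff_deriv_top hq)

lemma contDiff_iterate_cayleyDeriv {q : ℝ → ℂ} (hq : ContDiff ℝ (⊤ : ℕ∞) q) (N : ℕ) :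
    ContDiff ℝ (⊤ : ℕ∞) (cayleyDeriv^[N] q) := by
  induction N with
  | zero => exact hq
  | succ N ih => rw [Function.iterate_succ_apply']; exact contDiff_cayleyDeriv ih

lemma deriv_eq_zero_of_two_lt {q : ℝ → ℂ} (h : ∀ y, 2 < |y| → q y = 0) {y : ℝ} (hy : 2 < |y|) :
    deriv q y = 0 := by
  have : q =ᶠ[𝓝 y] fun _ => 0 := by
    filter_upwards [(isOpen_lt continuous_const continuous_abs).mem_nhds hy] with z hz using h z hz
  simp [this.deriv_eq]

lemma iterate_cayleyDeriv_eq_zero {q : ℝ → ℂ} (h : ∀ y, 2 < |y| → q y = 0) (N : ℕ) :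
    ∀ y, 2 < |y| → (cayleyDeriv^[N] q) y = 0 := by
  induction N with
  | zero => exact h
  | succ N ih =>
    intro y hy
    rw [Function.iterate_succ_apply', cayleyDeriv, deriv_eq_zero_of_two_lt ih hy, mul_zero]

lemma hasDerivAt_tanLift {q : ℝ → ℂ} (hq : ContDiff ℝ (⊤ : ℕ∞) q) (h : ∀ y, 2 < |y| → q y = 0)
    (φ : ℝ) : HasDerivAt (tanLift q) (tanLift (cayleyDeriv q) φ) φ := by
  by_cases hφ : |φ| < Real.pi / 2
  · have hcos : 0 < Real.cos φ := Real.cos_pos_of_mem_Ioo (abs_lt.1 hφ)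
    have h1 : HasDerivAt (fun φ => q (Real.tan φ)) (tanLift (cayleyDeriv q) φ) φ := by
      have hd : HasDerivAt q (deriv q (Real.tan φ)) (Real.tan φ) :=
        ((hq.differentiable (by simp)) _).hasDerivAt
      refine (hd.scomp φ (Real.hasDerivAt_tan hcos.ne')).congr_deriv ?_
      rw [tanLift, if_pos hφ, cayleyDeriv, ← Real.inv_one_add_tan_sq hcos.ne']
      simp
    refine h1.congr_of_eventuallyEq ?_
    filter_upwards [(isOpen_lt continuous_abs continuous_const).mem_nhds hφ] with ψ hψ
    rw [tanLift, if_pos hψ]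
  · rw [tanLift, if_neg hφ]
    refine (hasDerivAt_const φ (0 : ℂ)).congr_of_eventuallyEq ?_
    have h2 : Real.arctan 2 < |φ| := (Real.arctan_lt_pi_div_two 2).trans_le (not_lt.1 hφ)
    filter_upwards [(isOpen_lt continuous_const continuous_abs).mem_nhds h2] with ψ hψ
    rw [tanLift]
    split_ifs with h3
    · refine h _ ?_
      have hψ' : Real.arctan 2 < |ψ| := hψ
      have h4 : Real.tan (Real.arctan 2) < Real.tan |ψ| :=
        Real.tan_lt_tan_of_lt_of_lt_pi_div_two (Real.neg_pi_div_two_lt_arctan 2) h3 hψ'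
      rw [Real.tan_arctan] at h4
      rcases abs_cases ψ with ⟨he, _⟩ | ⟨he, _⟩
      · rw [he] at h4
        exact h4.trans_le (le_abs_self _)
      · rw [he, Real.tan_neg] at h4
        exact h4.trans_le (neg_le_abs _)
    · rfl

lemma tanLift_arctan (q : ℝ → ℂ) (y : ℝ) : tanLift q (Real.arctan y) = q y := by
  rw [tanLift, if_pos (abs_lt.2 ⟨Real.neg_pi_div_two_lt_arctan y, Real.arctan_lt_pi_div_two y⟩),
    Real.tan_arctan]

lemma continuous_tanLift {q : ℝ → ℂ} (hq : ContDiff ℝ (⊤ : ℕ∞) q)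
    (h : ∀ y, 2 < |y| → q y = 0) : Continuous (tanLift q) :=
  continuous_iff_continuousAt.2 fun φ => (hasDerivAt_tanLift hq h φ).continuousAt

lemma integrable_of_eq_zero_of_two_lt {E : Type*} [NormedAddCommGroup E] {q : ℝ → E}
    (hq : Continuous q) (h : ∀ y, 2 < |y| → q y = 0) : Integrable q :=
  hq.integrable_of_hasCompactSupport <|
    HasCompactSupport.intro (isCompact_Icc (a := (-2 : ℝ)) (b := 2)) fun y hy =>
      h y (by contrapose! hy; exact abs_le.1 hy)

lemma integral_norm_tanLift_le {q : ℝ → ℂ} (hq : Continuous q) (h : ∀ y, 2 < |y| → q y = 0) :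
    ∫ φ in (-(Real.pi / 2))..(Real.pi / 2), ‖tanLift q φ‖ ≤ ∫ y, ‖q y‖ := by
  have hpi := Real.pi_pos
  have himg : Real.arctan '' Set.univ = Set.Ioo (-(Real.pi / 2)) (Real.pi / 2) := by
    rw [Set.image_univ, Real.range_arctan]
  rw [intervalIntegral.integral_of_le (by linarith), integral_Ioc_eq_integral_Ioo, ← himg,
    integral_image_eq_integral_abs_deriv_smul MeasurableSet.univ
      (fun x _ => (Real.hasDerivAt_arctan x).hasDerivWithinAt) Real.arctan_injective.injOn,
    Measure.restrict_univ]
  have hle : ∀ y : ℝ, |1 / (1 + y ^ 2)| ≤ 1 := fun y => by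
    rw [abs_of_pos (by positivity), div_le_one (by positivity)]
    nlinarith [sq_nonneg y]
  have hi := (integrable_of_eq_zero_of_two_lt hq h).norm
  simp only [tanLift_arctan, smul_eq_mul]
  refine integral_mono_of_nonneg (Filter.Eventually.of_forall fun y => by positivity) hi
    (Filter.Eventually.of_forall fun y => ?_)
  exact mul_le_of_le_one_left (norm_nonneg _) (hle y)

/-- The Fourier coefficients of `tanLift q` on `[-π/2, π/2]`. -/
noncomputable def tanCoeff (q : ℝ → ℂ) (n : ℤ) : ℂ :=
  fourierCoeffOn (lt_add_of_pos_right (-(Real.pi / 2)) Real.pi_pos) (tanLift q) n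

lemma tanLift_boundary (q : ℝ → ℂ) :
    tanLift q (-(Real.pi / 2)) = 0 ∧ tanLift q (-(Real.pi / 2) + Real.pi) = 0 := by
  have hpi := Real.pi_pos
  constructor
  · rw [tanLift, if_neg (by rw [abs_neg, abs_of_pos (by linarith)]; exact lt_irrefl _)]
  · rw [tanLift, if_neg (by
      rw [show -(Real.pi / 2) + Real.pi = Real.pi / 2 by ring, abs_of_pos (by linarith)]
      exact lt_irrefl _)]

lemma norm_tanCoeff_le {q : ℝ → ℂ} (hq : Continuous q) (h : ∀ y, 2 < |y| → q y = 0) (n : ℤ) :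
    ‖tanCoeff q n‖ ≤ ∫ y, ‖q y‖ := by
  have hpi := Real.pi_gt_three
  rw [tanCoeff, fourierCoeffOn_eq_integral, norm_smul,
    show -(Real.pi / 2) + Real.pi = Real.pi / 2 by ring]
  have h1 : ‖1 / (Real.pi / 2 - -(Real.pi / 2))‖ ≤ 1 := by
    rw [show Real.pi / 2 - -(Real.pi / 2) = Real.pi by ring, Real.norm_of_nonneg (by positivity),
      div_le_one (by positivity)]
    linarith
  refine (mul_le_of_le_one_left (norm_nonneg _) h1).trans ?_
  refine (intervalIntegral.norm_integral_le_integral_norm (by linarith)).trans ?_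
  simpa only [norm_smul, fourier_apply, Circle.norm_coe, one_mul] using
    integral_norm_tanLift_le hq h

lemma tanCoeff_eq {q : ℝ → ℂ} (hq : ContDiff ℝ (⊤ : ℕ∞) q) (h : ∀ y, 2 < |y| → q y = 0)
    {n : ℤ} (hn : n ≠ 0) : tanCoeff q n = (2 * Complex.I * n)⁻¹ * tanCoeff (cayleyDeriv q) n := by
  have hpi : (Real.pi : ℂ) ≠ 0 := by exact_mod_cast Real.pi_ne_zero
  have hn' : (n : ℂ) ≠ 0 := by exact_mod_cast hn
  have h' : ∀ y, 2 < |y| → cayleyDeriv q y = 0 := iterate_cayleyDeriv_eq_zero h 1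
  rw [tanCoeff, fourierCoeffOn_of_hasDerivAt _ hn (fun φ _ => hasDerivAt_tanLift hq h φ)
    ((continuous_tanLift (contDiff_cayleyDeriv hq) h').intervalIntegrable _ _),
    (tanLift_boundary q).1, (tanLift_boundary q).2, ← tanCoeff]
  push_cast
  field_simp
  ring

lemma exp_two_mul_arctan (y : ℝ) :
    Complex.exp (2 * Complex.I * Real.arctan y) = -cayley 1 y := by
  have h1 : Complex.exp (Real.arctan y * Complex.I) =
      (1 + y * Complex.I) * ((1 / √(1 + y ^ 2) : ℝ) : ℂ) := by
    rw [Complex.exp_mul_I, ← Complex.ofReal_cos, ← Complex.ofReal_sin, Real.cos_arctan,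
      Real.sin_arctan]
    push_cast
    ring
  have h2 : (((1 / √(1 + y ^ 2) : ℝ) : ℂ)) ^ 2 = ((1 + y ^ 2 : ℝ) : ℂ)⁻¹ := by
    rw [← Complex.ofReal_pow, div_pow, Real.sq_sqrt (by positivity), one_pow, one_div,
      Complex.ofReal_inv]
  have h3 := ofReal_add_mul_I_ne_zero one_ne_zero y
  have h4 : (((1 + y ^ 2 : ℝ)) : ℂ) ≠ 0 := by exact_mod_cast (by positivity : (1 + y ^ 2 : ℝ) ≠ 0)
  rw [show 2 * Complex.I * (Real.arctan y : ℂ) = (2 : ℕ) * (Real.arctan y * Complex.I) by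
    push_cast; ring, Complex.exp_nat_mul, h1, mul_pow, h2, cayley, res]
  push_cast at h3 h4 ⊢
  rw [one_mul] at h3 ⊢
  rw [← div_eq_mul_inv, ← div_eq_mul_inv, ← neg_div, div_eq_div_iff h4 h3]
  linear_combination (2 * (y : ℂ) + y ^ 2 * Complex.I + y ^ 3) * Complex.I_sq

/-- The sign of the half line of frequencies indexed by a Boolean. -/
def boolSign (s : Bool) : ℝ := if s then -1 else 1

/-- Integers as nonnegative integers (`false`) and negative ones (`true`). -/
def boolNatEquivInt : Bool × ℕ ≃ ℤ := (Equiv.boolProdEquivSum ℕ).trans Equiv.intEquivNatSumNat.symm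

lemma norm_tanCoeff_mul_le {q : ℝ → ℂ} (hq : ContDiff ℝ (⊤ : ℕ∞) q)
    (h : ∀ y, 2 < |y| → q y = 0) (N : ℕ) {n : ℤ} (hn : n ≠ 0) :
    ‖tanCoeff q n‖ * (2 * |(n : ℝ)|) ^ N ≤ ∫ y, ‖(cayleyDeriv^[N] q) y‖ := by
  have key : ∀ N, ‖tanCoeff q n‖ * (2 * |(n : ℝ)|) ^ N = ‖tanCoeff (cayleyDeriv^[N] q) n‖ := by
    intro N
    induction N with
    | zero => simp
    | succ N ih =>
      rw [Function.iterate_succ_apply', pow_succ, ← mul_assoc, ih,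
        tanCoeff_eq (contDiff_iterate_cayleyDeriv hq N) (iterate_cayleyDeriv_eq_zero h N) hn]
      have : |(n : ℝ)| ≠ 0 := by simpa using hn
      simp only [norm_mul, norm_inv, Complex.norm_I, Complex.norm_intCast, Complex.norm_ofNat]
      field_simp
  rw [key]
  exact norm_tanCoeff_le (contDiff_iterate_cayleyDeriv hq N).continuous
    (iterate_cayleyDeriv_eq_zero h N) n

lemma norm_tanCoeff_boolNatEquivInt_le {q : ℝ → ℂ} (hq : ContDiff ℝ (⊤ : ℕ∞) q)
    (h : ∀ y, 2 < |y| → q y = 0) (N : ℕ) (s : Bool) (k : ℕ) :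
    ‖tanCoeff q (boolNatEquivInt (s, k))‖ * (1 + k) ^ N ≤
      (∫ y, ‖q y‖) + ∫ y, ‖(cayleyDeriv^[N] q) y‖ := by
  have h0 : 0 ≤ ∫ y, ‖q y‖ := integral_nonneg fun _ => norm_nonneg _
  have h0' : 0 ≤ ∫ y, ‖(cayleyDeriv^[N] q) y‖ := integral_nonneg fun _ => norm_nonneg _
  by_cases hn : boolNatEquivInt (s, k) = 0
  · have hk : k = 0 := by
      cases s with
      | false => exact Int.ofNat.inj hn
      | true =>
        exact absurd hn
          (by simp [boolNatEquivInt, Equiv.boolProdEquivSum, Equiv.intEquivNatSumNat])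
    have := norm_tanCoeff_le hq.continuous h (boolNatEquivInt (s, k))
    subst hk
    simpa using this.trans (le_add_of_nonneg_right h0')
  · refine le_trans ?_ ((norm_tanCoeff_mul_le hq h N hn).trans (le_add_of_nonneg_left h0))
    have : (1 + k : ℝ) ≤ 2 * |(boolNatEquivInt (s, k) : ℝ)| := by
      cases s with
      | false =>
        have hk : k ≠ 0 := fun hk => hn (by rw [hk]; rfl)
        have h1 : (1 : ℝ) ≤ k := by exact_mod_cast Nat.one_le_iff_ne_zero.2 hk
        change (1 + k : ℝ) ≤ 2 * |((Int.ofNat k : ℤ) : ℝ)|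
        rw [Int.ofNat_eq_natCast, Int.cast_natCast, Nat.abs_cast]
        linarith
      | true =>
        change (1 + k : ℝ) ≤ 2 * |((Int.negSucc k : ℤ) : ℝ)|
        rw [Int.cast_negSucc, abs_neg, Nat.abs_cast]
        push_cast
        linarith [k.cast_nonneg (α := ℝ)]
    gcongr

lemma summable_tanCoeff {q : ℝ → ℂ} (hq : ContDiff ℝ (⊤ : ℕ∞) q) (h : ∀ y, 2 < |y| → q y = 0) :
    Summable (tanCoeff q) := by
  rw [← boolNatEquivInt.summable_iff]
  have hs : Summable fun k : ℕ => (((k + 1 : ℕ) : ℝ) ^ 2)⁻¹ :=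
    (summable_nat_add_iff 1).2 (Real.summable_nat_pow_inv.2 one_lt_two)
  refine Summable.of_norm ((summable_prod_of_nonneg fun _ => norm_nonneg _).2
    ⟨fun s => ?_, Summable.of_finite⟩)
  refine (hs.mul_left ((∫ y, ‖q y‖) + ∫ y, ‖(cayleyDeriv^[2] q) y‖)).of_nonneg_of_le
    (fun _ => norm_nonneg _) fun k => ?_
  rw [← div_eq_mul_inv, le_div_iff₀ (by positivity)]
  rw [Nat.cast_succ, add_comm (k : ℝ) 1]
  exact norm_tanCoeff_boolNatEquivInt_le hq h 2 s k

lemma hasSum_tanCoeff {q : ℝ → ℂ} (hq : ContDiff ℝ (⊤ : ℕ∞) q) (h : ∀ y, 2 < |y| → q y = 0)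
    (y : ℝ) : HasSum (fun n : ℤ => tanCoeff q n * (-cayley 1 y) ^ n) (q y) := by
  have : Fact (0 < Real.pi) := ⟨Real.pi_pos⟩
  let f : C(AddCircle Real.pi, ℂ) :=
    ⟨AddCircle.liftIco Real.pi (-(Real.pi / 2)) (tanLift q), AddCircle.liftIco_continuous
      ((tanLift_boundary q).1.trans (tanLift_boundary q).2.symm)
      (continuous_tanLift hq h).continuousOn⟩
  have hf : fourierCoeff f = tanCoeff q := by
    ext n
    exact fourierCoeff_liftIco_eq _ _
  have hsum := has_pointwise_sum_fourier_series_of_summable (f := f)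
    (by rw [hf]; exact summable_tanCoeff hq h) (Real.arctan y : ℝ)
  rw [hf] at hsum
  have hval : f (Real.arctan y : ℝ) = q y := by
    refine (AddCircle.liftIco_coe_apply ⟨(Real.neg_pi_div_two_lt_arctan y).le, ?_⟩).trans
      (tanLift_arctan q y)
    have := Real.arctan_lt_pi_div_two y
    linarith
  rw [hval] at hsum
  convert hsum using 2 with n
  rw [fourier_coe_apply, smul_eq_mul, ← exp_two_mul_arctan, ← Complex.exp_int_mul]
  congr 2
  have hpi : (Real.pi : ℂ) ≠ 0 := by exact_mod_cast Real.pi_ne_zero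
  field_simp

lemma iterate_cayleyDeriv_add {p q : ℝ → ℂ} (hp : ContDiff ℝ (⊤ : ℕ∞) p)
    (hq : ContDiff ℝ (⊤ : ℕ∞) q) (N : ℕ) :
    cayleyDeriv^[N] (fun y => p y + q y) =
      fun y => (cayleyDeriv^[N] p) y + (cayleyDeriv^[N] q) y := by
  induction N with
  | zero => rfl
  | succ N ih =>
    ext y
    have h1 := (contDiff_iterate_cayleyDeriv hp N).differentiable (by simp) y
    have h2 := (contDiff_iterate_cayleyDeriv hq N).differentiable (by simp) y
    simp only [Function.iterate_succ_apply', ih, cayleyDeriv]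
    rw [deriv_fun_add h1 h2]
    ring

lemma exists_norm_iterate_cayleyDeriv_le (N : ℕ) {m : ℝ → ℂ} (hm : ContDiff ℝ (⊤ : ℕ∞) m) :
    ∃ K : ℝ, 0 ≤ K ∧ ∀ h : ℝ → ℂ, ContDiff ℝ (⊤ : ℕ∞) h → ∀ y, |y| ≤ 2 →
      ‖(cayleyDeriv^[N] fun y => m y * h y) y‖ ≤
        K * ∑ r ∈ Finset.range (N + 1), ‖iteratedDeriv r h y‖ := by
  induction N generalizing m with
  | zero =>
    obtain ⟨K, hK⟩ := (isCompact_Icc (a := (-2 : ℝ)) (b := 2)).exists_bound_of_continuousOn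
      hm.continuous.continuousOn
    have hK0 : 0 ≤ K := (norm_nonneg _).trans (hK 0 (by norm_num))
    refine ⟨K, hK0, fun h _ y hy => ?_⟩
    simpa using mul_le_mul_of_nonneg_right (hK y (abs_le.1 hy)) (norm_nonneg (h y))
  | succ N ih =>
    have hw : ContDiff ℝ (⊤ : ℕ∞) fun y : ℝ => ((1 + y ^ 2 : ℝ) : ℂ) :=
      Complex.ofRealCLM.contDiff.comp (by fun_prop : ContDiff ℝ (⊤ : ℕ∞) fun y : ℝ => 1 + y ^ 2)
    have hm2 : ContDiff ℝ (⊤ : ℕ∞) fun y : ℝ => ((1 + y ^ 2 : ℝ) : ℂ) * m y := hw.mul hm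
    obtain ⟨K1, hK1, H1⟩ := ih (contDiff_cayleyDeriv hm)
    obtain ⟨K2, hK2, H2⟩ := ih hm2
    refine ⟨K1 + K2, add_nonneg hK1 hK2, fun h hh y hy => ?_⟩
    have hd := contDiff_deriv_top hh
    have hB : cayleyDeriv (fun y => m y * h y) = fun y =>
        cayleyDeriv m y * h y + (((1 + y ^ 2 : ℝ) : ℂ) * m y) * deriv h y := by
      ext y
      rw [cayleyDeriv, deriv_fun_mul (hm.differentiable (by simp) y)
        (hh.differentiable (by simp) y), cayleyDeriv]
      ring
    rw [Function.iterate_succ_apply, hB,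
      iterate_cayleyDeriv_add ((contDiff_cayleyDeriv hm).mul hh) (hm2.mul hd)]
    refine (norm_add_le _ _).trans ?_
    rw [add_mul]
    refine add_le_add ((H1 h hh y hy).trans ?_) ((H2 _ hd y hy).trans ?_)
    · refine mul_le_mul_of_nonneg_left ?_ hK1
      rw [Finset.sum_range_succ _ (N + 1)]
      exact le_add_of_nonneg_right (norm_nonneg _)
    · refine mul_le_mul_of_nonneg_left ?_ hK2
      rw [Finset.sum_range_succ' _ (N + 1)]
      simp only [iteratedDeriv_succ']
      exact le_add_of_nonneg_right (norm_nonneg _)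

lemma res_mul_zpow_boolNatEquivInt (s : Bool) (k : ℕ) (y : ℝ) :
    res 1 y * (-cayley 1 y) ^ boolNatEquivInt (s, k) =
      (-1) ^ boolNatEquivInt (s, k) * block (boolSign s) k y := by
  have h1 := ofReal_add_mul_I_ne_zero one_ne_zero y
  have h2 := ofReal_add_mul_I_ne_zero (neg_ne_zero.2 one_ne_zero) y
  rw [neg_eq_neg_one_mul (cayley 1 y), mul_zpow, mul_left_comm]
  congr 1
  cases s with
  | false =>
    change res 1 y * cayley 1 y ^ (k : ℤ) = _
    rw [zpow_natCast]
    rfl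
  | true =>
    change res 1 y * cayley 1 y ^ Int.negSucc k = block (-1) k y
    have hinv : (cayley 1 y)⁻¹ = cayley (-1) y := by
      simp only [cayley, res]
      push_cast at h1 h2 ⊢
      rw [mul_inv, inv_inv, mul_comm]
      congr 1
      · ring
      · congr 1; ring
    have hres : res 1 y * (cayley 1 y)⁻¹ = res (-1) y := by
      rw [hinv]
      simp only [cayley, res]
      push_cast at h1 h2 ⊢
      have : (y : ℂ) - -1 * Complex.I = y + 1 * Complex.I := by ring
      rw [this, inv_mul_cancel_left₀ h1]
    rw [zpow_negSucc, ← inv_pow, pow_succ', ← mul_assoc, hres, hinv]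
    rfl

/-- Expansion of a smooth function supported in `[-2, 2]` into rational blocks of scale one. -/
theorem exists_block_expansion : ∃ K : ℕ → ℝ, (∀ N, 0 ≤ K N) ∧ ∀ h : ℝ → ℂ,
    ContDiff ℝ (⊤ : ℕ∞) h → (∀ y, 2 < |y| → h y = 0) → ∃ c : Bool → ℕ → ℂ,
      (∀ s, RapidDecay
        (fun N => K N * ∑ r ∈ Finset.range (N + 1), ∫ y, ‖iteratedDeriv r h y‖) (c s)) ∧
      ∀ y, HasSum (fun q : Bool × ℕ => c q.1 q.2 * block (boolSign q.1) q.2 y) (h y) := by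
  choose K hK0 hK using fun N => exists_norm_iterate_cayleyDeriv_le N contDiff_shiftI
  refine ⟨fun N => K 0 + K N, fun N => add_nonneg (hK0 0) (hK0 N), fun h hh hsupp => ?_⟩
  set q : ℝ → ℂ := fun y => shiftI y * h y with hq
  have hqc : ContDiff ℝ (⊤ : ℕ∞) q := contDiff_shiftI.mul hh
  have hq0 : ∀ y, 2 < |y| → q y = 0 := fun y hy => by rw [hq]; simp [hsupp y hy]
  have hr0 : ∀ r, ∀ y, 2 < |y| → iteratedDeriv r h y = 0 := by
    intro r
    induction r with
    | zero => simpa using hsupp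
    | succ r ih =>
      intro y hy
      rw [iteratedDeriv_succ]
      exact deriv_eq_zero_of_two_lt ih hy
  have hri : ∀ r, Integrable fun y => ‖iteratedDeriv r h y‖ := fun r =>
    (integrable_of_eq_zero_of_two_lt
      (hh.continuous_iteratedDeriv r (by exact_mod_cast le_top)) (hr0 r)).norm
  have hbd : ∀ N, ∫ y, ‖(cayleyDeriv^[N] q) y‖ ≤
      K N * ∑ r ∈ Finset.range (N + 1), ∫ y, ‖iteratedDeriv r h y‖ := by
    intro N
    rw [← integral_finsetSum _ fun r _ => hri r, ← integral_const_mul]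
    refine integral_mono_of_nonneg (Filter.Eventually.of_forall fun y => norm_nonneg _)
      ((integrable_finsetSum _ fun r _ => hri r).const_mul _)
      (Filter.Eventually.of_forall fun y => ?_)
    rcases le_or_gt |y| 2 with hy | hy
    · exact hK N h hh y hy
    · dsimp only
      rw [iterate_cayleyDeriv_eq_zero hq0 N y hy, norm_zero]
      exact mul_nonneg (hK0 N) (Finset.sum_nonneg fun _ _ => norm_nonneg _)
  refine ⟨fun s k => (-1) ^ boolNatEquivInt (s, k) * tanCoeff q (boolNatEquivInt (s, k)),
    fun s N k => ?_, fun y => ?_⟩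
  · beta_reduce
    rw [norm_mul, norm_zpow, norm_neg, norm_one, one_zpow, one_mul, add_mul]
    refine (norm_tanCoeff_boolNatEquivInt_le hqc hq0 N s k).trans (add_le_add ?_ (hbd N))
    refine (hbd 0).trans (mul_le_mul_of_nonneg_left ?_ (hK0 0))
    exact Finset.sum_le_sum_of_subset_of_nonneg (by simp)
      fun r _ _ => integral_nonneg fun _ => norm_nonneg _
  · have := (hasSum_tanCoeff hqc hq0 y).mul_left (res 1 y)
    have hres : res 1 y * q y = h y := by
      have h1 : res 1 y * shiftI y = 1 := by
        rw [res, shiftI, Complex.ofReal_one, one_mul, inv_mul_cancel₀]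
        exact shiftI_ne_zero y
      rw [hq]
      dsimp only
      rw [← mul_assoc, h1, one_mul]
    rw [hres, ← boolNatEquivInt.hasSum_iff] at this
    refine this.congr_fun fun ⟨s, k⟩ => ?_
    dsimp only [Function.comp]
    rw [mul_left_comm, res_mul_zpow_boolNatEquivInt]
    ring

lemma iteratedDeriv_eq_zero_of_isOpen {f : ℝ → ℂ} {U : Set ℝ} (hU : IsOpen U)
    (h : ∀ y ∈ U, f y = 0) (r : ℕ) {y : ℝ} (hy : y ∈ U) : iteratedDeriv r f y = 0 := by
  have : f =ᶠ[𝓝 y] fun _ => 0 := Filter.eventuallyEq_of_mem (hU.mem_nhds hy) h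
  rw [this.iteratedDeriv_eq]
  simp

/-- A smooth cutoff, equal to `1` on `[-1, 1]` and vanishing outside `(-2, 2)`. -/
noncomputable def baseBump : ContDiffBump (0 : ℝ) := ⟨1, 2, zero_lt_one, one_lt_two⟩

/-- The dyadic partition of unity, each piece rescaled to unit size. -/
noncomputable def dyadicCutoff : ℕ → ℝ → ℂ
  | 0, y => (baseBump y : ℝ)
  | _ + 1, y => (baseBump y - baseBump (2 * y) : ℝ)

lemma baseBump_eq_one {y : ℝ} (h : |y| ≤ 1) : baseBump y = 1 :=
  baseBump.one_of_mem_closedBall (by simpa [baseBump] using h)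

lemma baseBump_eq_zero {y : ℝ} (h : 2 ≤ |y|) : baseBump y = 0 :=
  baseBump.zero_of_le_dist (by simpa [baseBump] using h)

lemma contDiff_dyadicCutoff (m : ℕ) : ContDiff ℝ (⊤ : ℕ∞) (dyadicCutoff m) := by
  cases m with
  | zero => exact Complex.ofRealCLM.contDiff.comp baseBump.contDiff
  | succ m =>
    exact Complex.ofRealCLM.contDiff.comp
      (baseBump.contDiff.sub (baseBump.contDiff.comp (by fun_prop)))

lemma dyadicCutoff_eq_zero {m : ℕ} {y : ℝ} (h : 2 ≤ |y|) : dyadicCutoff m y = 0 := by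
  cases m with
  | zero => simp [dyadicCutoff, baseBump_eq_zero h]
  | succ m =>
    have h2 : 2 ≤ |2 * y| := by
      rw [abs_mul, abs_two]
      linarith
    simp [dyadicCutoff, baseBump_eq_zero h, baseBump_eq_zero h2]

lemma dyadicCutoff_eq_zero_of_le {m : ℕ} (hm : m ≠ 0) {y : ℝ} (h : 2 * |y| ≤ 1) :
    dyadicCutoff m y = 0 := by
  obtain ⟨m, rfl⟩ := Nat.exists_eq_succ_of_ne_zero hm
  have h2 : |2 * y| ≤ 1 := by rwa [abs_mul, abs_two]
  have h1 : |y| ≤ 1 := by linarith [abs_nonneg y]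
  simp [dyadicCutoff, baseBump_eq_one h1, baseBump_eq_one h2]

lemma hasSum_dyadicCutoff (x : ℝ) : HasSum (fun m => dyadicCutoff m (x / 2 ^ m)) 1 := by
  obtain ⟨M, hM⟩ := pow_unbounded_of_one_lt |x| one_lt_two
  have hsum : ∀ M : ℕ, ∑ m ∈ Finset.range (M + 1), dyadicCutoff m (x / 2 ^ m) =
      (baseBump (x / 2 ^ M) : ℝ) := by
    intro M
    induction M with
    | zero => simp [dyadicCutoff]
    | succ M ih =>
      rw [Finset.sum_range_succ, ih, dyadicCutoff]
      have : 2 * (x / 2 ^ (M + 1)) = x / 2 ^ M := by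
        rw [pow_succ]
        field_simp
      rw [this]
      push_cast
      ring
  have h1 : |x / 2 ^ M| ≤ 1 := by
    rw [abs_div, abs_pow, abs_two, div_le_one (by positivity)]
    exact hM.le
  have h := hasSum_sum_of_ne_finset_zero (f := fun m => dyadicCutoff m (x / 2 ^ m))
    (s := Finset.range (M + 1)) (L := SummationFilter.unconditional ℕ) fun m hm => by
      have hm' : M + 1 ≤ m := by simpa using hm
      refine dyadicCutoff_eq_zero_of_le (by lia) ?_
      rw [abs_div, abs_pow, abs_two, ← mul_div_assoc, div_le_one (by positivity)]
      calc 2 * |x| ≤ 2 * 2 ^ M := by linarith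
        _ = 2 ^ (M + 1) := by ring
        _ ≤ 2 ^ m := pow_le_pow_right₀ one_le_two hm'
  rwa [hsum, baseBump_eq_one h1, Complex.ofReal_one] at h

lemma exists_norm_iteratedDeriv_dyadicCutoff_le :
    ∃ B : ℕ → ℝ, (∀ i, 0 ≤ B i) ∧ ∀ i m y, ‖iteratedDeriv i (dyadicCutoff m) y‖ ≤ B i := by
  have key : ∀ i m, ∃ B : ℝ, ∀ y, ‖iteratedDeriv i (dyadicCutoff m) y‖ ≤ B := by
    intro i m
    obtain ⟨B, hB⟩ := (isCompact_Icc (a := (-2 : ℝ)) (b := 2)).exists_bound_of_continuousOn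
      ((contDiff_dyadicCutoff m).continuous_iteratedDeriv i
        (by exact_mod_cast le_top)).continuousOn
    refine ⟨B, fun y => ?_⟩
    rcases le_or_gt |y| 2 with hy | hy
    · exact hB y (abs_le.1 hy)
    · rw [iteratedDeriv_eq_zero_of_isOpen (isOpen_lt continuous_const continuous_abs)
        (fun z hz => dyadicCutoff_eq_zero hz.le) i hy, norm_zero]
      exact (norm_nonneg _).trans (hB 0 (by norm_num))
  choose B hB using key
  refine ⟨fun i => max (B i 0) (B i 1),
    fun i => le_max_of_le_left ((norm_nonneg _).trans (hB i 0 0)), fun i m y => ?_⟩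
  cases m with
  | zero => exact (hB i 0 y).trans (le_max_left _ _)
  | succ m => exact (hB i 1 y).trans (le_max_right _ _)

/-- The set where the `m`-th dyadic piece lives. -/
def annulus (m : ℕ) : Set ℝ := {x | |x| ≤ 2 * 2 ^ m ∧ (m = 0 ∨ 2 ^ m ≤ 2 * |x|)}

lemma isClosed_annulus (m : ℕ) : IsClosed (annulus m) := by
  refine (isClosed_le continuous_abs continuous_const).inter ?_
  change IsClosed {x : ℝ | m = 0 ∨ 2 ^ m ≤ 2 * |x|}
  by_cases hm : m = 0
  · simp [hm]
  · simpa [hm] using isClosed_le (f := fun _ : ℝ => (2 : ℝ) ^ m) (g := fun x => 2 * |x|)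
      (by fun_prop) (by fun_prop)

lemma sum_indicator_annulus_le (s : Finset ℕ) {G : ℝ → ℝ} (hG : ∀ x, 0 ≤ G x) (x : ℝ) :
    ∑ m ∈ s, (annulus m).indicator G x ≤ 3 * G x := by
  classical
  have h1 : ∑ m ∈ s, (annulus m).indicator G x = ((s.filter (x ∈ annulus ·)).card : ℝ) * G x := by
    simp only [Set.indicator_apply]
    rw [← Finset.sum_filter, Finset.sum_const, nsmul_eq_mul]
  rw [h1]
  refine mul_le_mul_of_nonneg_right ?_ (hG x)
  rcases (s.filter (x ∈ annulus ·)).eq_empty_or_nonempty with he | hne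
  · simp [he]
  · obtain ⟨m₀, hm₀, hmin⟩ := Finset.exists_min_image _ id hne
    have hsub : s.filter (x ∈ annulus ·) ⊆ Finset.Icc m₀ (m₀ + 2) := by
      intro m hm
      have hle : m₀ ≤ m := hmin m hm
      refine Finset.mem_Icc.2 ⟨hle, ?_⟩
      have h0 := (Finset.mem_filter.1 hm₀).2.1
      rcases (Finset.mem_filter.1 hm).2.2 with h | h
      · lia
      · have : (2 : ℝ) ^ m ≤ 2 ^ (m₀ + 2) := by
          calc (2 : ℝ) ^ m ≤ 2 * (2 * 2 ^ m₀) := h.trans (by linarith)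
            _ = _ := by ring
        exact (pow_le_pow_iff_right₀ one_lt_two).1 this
    have := Finset.card_le_card hsub
    rw [Nat.card_Icc] at this
    exact_mod_cast this.trans (by lia)

lemma rpow_le_of_comparable {a b C e : ℝ} (ha : 0 < a) (hb : 0 < b) (hC : 1 ≤ C)
    (hab : a ≤ C * b) (hba : b ≤ C * a) : a ^ e ≤ C ^ |e| * b ^ e := by
  have hC0 : 0 < C := by linarith
  rcases le_total 0 e with he | he
  · rw [abs_of_nonneg he, ← Real.mul_rpow hC0.le hb.le]
    exact Real.rpow_le_rpow ha.le hab he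
  · have h := Real.rpow_le_rpow_of_nonpos hb hba he
    rw [Real.mul_rpow hC0.le ha.le] at h
    rw [abs_of_nonpos he, Real.rpow_neg hC0.le]
    have : 0 < C ^ e := Real.rpow_pos_of_pos hC0 _
    rw [← div_eq_inv_mul, le_div_iff₀ this]
    linarith

lemma jb_le_of_mem_annulus {m : ℕ} {x : ℝ} (hx : x ∈ annulus m) :
    (2 : ℝ) ^ m ≤ 4 * jb x ∧ jb x ≤ 4 * 2 ^ m := by
  have ht : (1 : ℝ) ≤ 2 ^ m := one_le_pow₀ one_le_two
  have habs := abs_nonneg x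
  constructor
  · rcases hx.2 with h | h
    · simp only [h, pow_zero]
      linarith [one_le_jb x]
    · have : |x| ≤ jb x := Real.abs_le_sqrt (by linarith)
      linarith
  · refine (Real.sqrt_le_left (by positivity)).2 ?_
    rw [← sq_abs]
    nlinarith [hx.1]

/-- The `m`-th dyadic piece of `g`, rescaled to unit size. -/
noncomputable def dyadicPiece (g : ℝ → ℂ) (m : ℕ) (y : ℝ) : ℂ := dyadicCutoff m y * g (2 ^ m * y)

lemma contDiff_dyadicPiece {g : ℝ → ℂ} (hg : ContDiff ℝ (⊤ : ℕ∞) g) (m : ℕ) :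
    ContDiff ℝ (⊤ : ℕ∞) (dyadicPiece g m) :=
  (contDiff_dyadicCutoff m).mul (hg.comp (by fun_prop))

lemma iteratedDeriv_dyadicPiece_eq_zero (g : ℝ → ℂ) (m r : ℕ) {y : ℝ}
    (hy : 2 ^ m * y ∉ annulus m) : iteratedDeriv r (dyadicPiece g m) y = 0 := by
  refine iteratedDeriv_eq_zero_of_isOpen
    (((isClosed_annulus m).preimage (continuous_const_mul ((2 : ℝ) ^ m))).isOpen_compl)
    (fun z hz => ?_) r hy
  have hp : (0 : ℝ) < 2 ^ m := by positivity
  have hz' : ¬ (|2 ^ m * z| ≤ 2 * 2 ^ m ∧ (m = 0 ∨ 2 ^ m ≤ 2 * |2 ^ m * z|)) := hz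
  rw [abs_mul, abs_of_pos hp, not_and_or, not_or, not_le, not_le] at hz'
  rw [dyadicPiece]
  rcases hz' with h | ⟨hm, h⟩
  · rw [dyadicCutoff_eq_zero (by nlinarith), zero_mul]
  · rw [dyadicCutoff_eq_zero_of_le hm (by nlinarith), zero_mul]

lemma exists_norm_iteratedDeriv_dyadicPiece_le {γ : ℝ} (h1 : -1 < γ) (h0 : γ ≤ 0) :
    ∃ D : ℕ → ℝ, (∀ r, 0 ≤ D r) ∧ ∀ g, ContDiff ℝ (⊤ : ℕ∞) g → ∀ r m y,
      ((2 : ℝ) ^ m) ^ (-γ) * ‖iteratedDeriv r (dyadicPiece g m) y‖ ≤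
        D r * (2 ^ m * (annulus m).indicator
          (fun x => ∑ i ∈ Finset.range (r + 1), tWeight γ i g x) (2 ^ m * y)) := by
  obtain ⟨B, hB0, hB⟩ := exists_norm_iteratedDeriv_dyadicCutoff_le
  refine ⟨fun r => ∑ i ∈ Finset.range (r + 1), (r.choose i : ℝ) * B i * 4 ^ (r + 1 : ℝ),
    fun r => Finset.sum_nonneg fun i _ => by have := hB0 i; positivity, fun g hg r m y => ?_⟩
  by_cases hy : 2 ^ m * y ∈ annulus m
  swap
  · rw [iteratedDeriv_dyadicPiece_eq_zero g m r hy, Set.indicator_of_notMem hy]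
    simp
  rw [Set.indicator_of_mem hy, Finset.sum_mul]
  have hp : (0 : ℝ) < 2 ^ m := by positivity
  refine (mul_le_mul_of_nonneg_left (norm_iteratedDeriv_mul_le (contDiff_dyadicCutoff m)
    (hg.comp (by fun_prop : ContDiff ℝ (⊤ : ℕ∞) fun y : ℝ => 2 ^ m * y)) r y)
    (by positivity)).trans ?_
  rw [Finset.mul_sum]
  refine Finset.sum_le_sum fun i hi => ?_
  have hir : i ≤ r := by simpa [Nat.lt_succ_iff] using hi
  obtain ⟨hj1, hj2⟩ := jb_le_of_mem_annulus hy
  have hcomp : iteratedDeriv (r - i) (g ∘ fun y => 2 ^ m * y) y =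
      ((2 : ℝ) ^ m) ^ (r - i) • iteratedDeriv (r - i) g (2 ^ m * y) := by
    have hgr : ContDiff ℝ ((r - i : ℕ) : ℕ∞) g := hg.of_le (by exact_mod_cast le_top)
    exact congrFun (iteratedDeriv_comp_const_smul hgr ((2 : ℝ) ^ m)) y
  have hpw : ((2 : ℝ) ^ m) ^ (-γ) * (2 ^ m) ^ (r - i) ≤
      4 ^ (r + 1 : ℝ) * (2 ^ m * jb (2 ^ m * y) ^ (((r - i : ℕ) : ℝ) - γ - 1)) := by
    have h := rpow_le_of_comparable (e := ((r - i : ℕ) : ℝ) - γ - 1) hp (jb_pos _)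
      (by norm_num) hj1 hj2
    have hri : (((r - i : ℕ) : ℝ)) ≤ r := by exact_mod_cast Nat.sub_le _ _
    have habs : |((r - i : ℕ) : ℝ) - γ - 1| ≤ r + 1 := by
      rw [abs_le]
      have := (r - i).cast_nonneg (α := ℝ)
      constructor <;> linarith
    have h4 := Real.rpow_le_rpow_of_exponent_le (by norm_num : (1 : ℝ) ≤ 4) habs
    calc ((2 : ℝ) ^ m) ^ (-γ) * (2 ^ m) ^ (r - i) =
          2 ^ m * (2 ^ m) ^ (((r - i : ℕ) : ℝ) - γ - 1) := by
            rw [← Real.rpow_natCast _ (r - i), ← Real.rpow_add hp]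
            nth_rewrite 2 [← Real.rpow_one ((2 : ℝ) ^ m)]
            rw [← Real.rpow_add hp]
            congr 1
            ring
      _ ≤ 2 ^ m * (4 ^ (r + 1 : ℝ) * jb (2 ^ m * y) ^ (((r - i : ℕ) : ℝ) - γ - 1)) := by
            have := Real.rpow_nonneg (jb_pos (2 ^ m * y)).le (((r - i : ℕ) : ℝ) - γ - 1)
            gcongr
            exact h.trans (mul_le_mul_of_nonneg_right h4 this)
      _ = _ := by ring
  have hle : tWeight γ (r - i) g (2 ^ m * y) ≤
      ∑ i ∈ Finset.range (r + 1), tWeight γ i g (2 ^ m * y) :=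
    Finset.single_le_sum (f := fun i => tWeight γ i g (2 ^ m * y))
      (fun _ _ => tWeight_nonneg _ _ _ _) (Finset.mem_range.2 (by lia))
  have hB' := hB i m y
  have hBi := hB0 i
  rw [hcomp, norm_smul, Real.norm_of_nonneg (by positivity)]
  set n' := ‖iteratedDeriv (r - i) g (2 ^ m * y)‖ with hn'
  have hn0 : 0 ≤ n' := norm_nonneg _
  calc _ = (r.choose i : ℝ) * ‖iteratedDeriv i (dyadicCutoff m) y‖ *
        (((2 : ℝ) ^ m) ^ (-γ) * (2 ^ m) ^ (r - i)) * n' := by ring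
    _ ≤ (r.choose i : ℝ) * B i *
        (4 ^ (r + 1 : ℝ) * (2 ^ m * jb (2 ^ m * y) ^ (((r - i : ℕ) : ℝ) - γ - 1))) * n' := by
          gcongr
    _ = (r.choose i : ℝ) * B i * 4 ^ (r + 1 : ℝ) *
        (2 ^ m * tWeight γ (r - i) g (2 ^ m * y)) := by
          rw [tWeight, ← hn']
          ring
    _ ≤ _ := by gcongr

lemma exists_sum_integral_dyadicPiece_le {γ : ℝ} (h1 : -1 < γ) (h0 : γ ≤ 0) :
    ∃ D : ℕ → ℝ, (∀ r, 0 ≤ D r) ∧ ∀ g, MemT γ g → ∀ r (s : Finset ℕ),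
      ∑ m ∈ s, ((2 : ℝ) ^ m) ^ (-γ) * ∫ y, ‖iteratedDeriv r (dyadicPiece g m) y‖ ≤
        D r * ∑ i ∈ Finset.range (r + 1), TNorm γ i g := by
  obtain ⟨D, hD0, hD⟩ := exists_norm_iteratedDeriv_dyadicPiece_le h1 h0
  refine ⟨fun r => D r * 3, fun r => mul_nonneg (hD0 r) zero_le_three, fun g hg r s => ?_⟩
  set G : ℝ → ℝ := fun x => ∑ i ∈ Finset.range (r + 1), tWeight γ i g x with hG
  have hG0 : ∀ x, 0 ≤ G x := fun x => Finset.sum_nonneg fun _ _ => tWeight_nonneg _ _ _ _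
  have hGi : Integrable G := integrable_finsetSum _ fun i _ => hg.2 i
  have hGm : ∀ m, Integrable ((annulus m).indicator G) := fun m =>
    hGi.indicator (isClosed_annulus m).measurableSet
  have hone : ∀ m : ℕ, ((2 : ℝ) ^ m) ^ (-γ) * ∫ y, ‖iteratedDeriv r (dyadicPiece g m) y‖ ≤
      D r * ∫ x, (annulus m).indicator G x := by
    intro m
    have hp : (0 : ℝ) < 2 ^ m := by positivity
    rw [← integral_const_mul]
    calc _ ≤ ∫ y, D r * (2 ^ m * (annulus m).indicator G (2 ^ m * y)) := by
          refine integral_mono_of_nonneg (Filter.Eventually.of_forall fun y => by positivity)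
            ((((hGm m).comp_mul_left' hp.ne').const_mul _).const_mul _)
            (Filter.Eventually.of_forall fun y => hD g hg.1 r m y)
      _ = _ := by
          rw [integral_const_mul, integral_const_mul, Measure.integral_comp_mul_left, smul_eq_mul,
            abs_of_pos (inv_pos.2 hp), mul_inv_cancel_left₀ hp.ne']
  calc _ ≤ ∑ m ∈ s, D r * ∫ x, (annulus m).indicator G x := Finset.sum_le_sum fun m _ => hone m
    _ = D r * ∫ x, ∑ m ∈ s, (annulus m).indicator G x := by
        rw [← Finset.mul_sum, integral_finsetSum _ fun m _ => hGm m]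
    _ ≤ D r * ∫ x, 3 * G x := by
        refine mul_le_mul_of_nonneg_left ?_ (hD0 r)
        exact integral_mono (integrable_finsetSum _ fun m _ => hGm m) (hGi.const_mul 3)
          fun x => sum_indicator_annulus_le s hG0 x
    _ = _ := by
        rw [integral_const_mul, hG, integral_finsetSum _ fun i _ => hg.2 i, mul_assoc]
        rfl

/-- The dyadic scales `± 2 ^ m`. -/
noncomputable def dyadicScale (ω : ℕ × Bool) : ℝ := boolSign ω.2 * 2 ^ ω.1

lemma abs_dyadicScale (ω : ℕ × Bool) : |dyadicScale ω| = 2 ^ ω.1 := by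
  rcases ω with ⟨m, _ | _⟩ <;> simp [dyadicScale, boolSign]

lemma one_le_abs_dyadicScale (ω : ℕ × Bool) : 1 ≤ |dyadicScale ω| := by
  rw [abs_dyadicScale]
  exact one_le_pow₀ one_le_two

lemma block_div {t : ℝ} (ht : t ≠ 0) (τ : ℝ) (k : ℕ) (x : ℝ) :
    block τ k (x / t) = t * block (τ * t) k x := by
  have htc : (t : ℂ) ≠ 0 := by exact_mod_cast ht
  have hres : res τ (x / t) = t * res (τ * t) x := by
    rw [res, res]
    rw [← inv_inv (t : ℂ), ← mul_inv]
    congr 1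
    push_cast
    field_simp
  have hcay : cayley τ (x / t) = cayley (τ * t) x := by
    rw [cayley, cayley, hres]
    push_cast
    field_simp
  rw [block, block, hres, hcay, mul_assoc]

lemma norm_block_le {τ : ℝ} (hτ : τ ≠ 0) (k : ℕ) (x : ℝ) : ‖block τ k x‖ ≤ |τ|⁻¹ := by
  rw [block, norm_mul, norm_pow, norm_cayley hτ, one_pow, mul_one, ← one_div,
    le_div_iff₀ (abs_pos.2 hτ), mul_comm]
  exact abs_mul_norm_res_le τ x

/-- Expansion of `g ∈ T^γ` into rational blocks of dyadic scales, with weighted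
coefficient bounds. -/
theorem exists_dyadic_expansion {γ : ℝ} (h1 : -1 < γ) (h0 : γ ≤ 0) :
    ∃ C : ℕ → ℝ, (∀ N, 0 ≤ C N) ∧ ∀ g, MemT γ g →
      ∃ (c : ℕ × Bool → ℕ → ℂ) (A : ℕ × Bool → ℕ → ℝ),
        (∀ ω, RapidDecay (A ω) (c ω)) ∧
        (∀ N, Summable (fun ω => A ω N * |dyadicScale ω| ^ (-1 - γ)) ∧
          ∑' ω, A ω N * |dyadicScale ω| ^ (-1 - γ) ≤
            C N * ∑ r ∈ Finset.range (N + 1), TNorm γ r g) ∧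
        ∀ x, HasSum (fun q : (ℕ × Bool) × ℕ => c q.1 q.2 * block (dyadicScale q.1) q.2 x)
          (g x) := by
  obtain ⟨K, hK0, hK⟩ := exists_block_expansion
  obtain ⟨D, hD0, hD⟩ := exists_sum_integral_dyadicPiece_le h1 h0
  refine ⟨fun N => K N * (∑ r ∈ Finset.range (N + 1), D r) * 2,
    fun N => mul_nonneg (mul_nonneg (hK0 N) (Finset.sum_nonneg fun r _ => hD0 r)) zero_le_two,
    fun g hg => ?_⟩
  choose c hc hsum using fun m => hK (dyadicPiece g m) (contDiff_dyadicPiece hg.1 m)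
    fun y hy => by rw [dyadicPiece, dyadicCutoff_eq_zero hy.le, zero_mul]
  set a : ℕ → ℕ → ℝ := fun N m =>
    K N * ∑ r ∈ Finset.range (N + 1), ∫ y, ‖iteratedDeriv r (dyadicPiece g m) y‖ with ha
  have ha0 : ∀ N m, 0 ≤ a N m := fun N m => mul_nonneg (hK0 N)
    (Finset.sum_nonneg fun r _ => integral_nonneg fun _ => norm_nonneg _)
  have hcA : ∀ ω : ℕ × Bool, RapidDecay (fun N => 2 ^ ω.1 * a N ω.1)
      (fun k => 2 ^ ω.1 * c ω.1 ω.2 k) := by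
    intro ω N k
    rw [norm_mul, norm_pow, Complex.norm_ofNat, mul_assoc]
    exact mul_le_mul_of_nonneg_left (hc ω.1 ω.2 N k) (by positivity)
  have hpart : ∀ N (s : Finset ℕ), ∑ m ∈ s, ((2 : ℝ) ^ m) ^ (-γ) * a N m ≤
      K N * (∑ r ∈ Finset.range (N + 1), D r) * ∑ r ∈ Finset.range (N + 1), TNorm γ r g := by
    intro N s
    calc _ = K N * ∑ r ∈ Finset.range (N + 1), ∑ m ∈ s,
          ((2 : ℝ) ^ m) ^ (-γ) * ∫ y, ‖iteratedDeriv r (dyadicPiece g m) y‖ := by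
          rw [Finset.sum_comm, Finset.mul_sum]
          refine Finset.sum_congr rfl fun m _ => ?_
          rw [ha, ← Finset.mul_sum]
          ring
      _ ≤ K N * ∑ r ∈ Finset.range (N + 1), D r * ∑ i ∈ Finset.range (N + 1), TNorm γ i g := by
          refine mul_le_mul_of_nonneg_left (Finset.sum_le_sum fun r hr => ?_) (hK0 N)
          refine (hD g hg r s).trans (mul_le_mul_of_nonneg_left ?_ (hD0 r))
          exact Finset.sum_le_sum_of_subset_of_nonneg
            (Finset.range_subset_range.2 (Finset.mem_range.1 hr)) fun i _ _ => TNorm_nonneg _ _ _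
      _ = _ := by rw [← Finset.sum_mul, mul_assoc]
  have hterm0 : ∀ N m, 0 ≤ ((2 : ℝ) ^ m) ^ (-γ) * a N m := fun N m =>
    mul_nonneg (by positivity) (ha0 N m)
  have hsm : ∀ N, Summable fun m => ((2 : ℝ) ^ m) ^ (-γ) * a N m := fun N =>
    summable_of_sum_le (hterm0 N) (hpart N)
  have hsb : Summable fun _ : Bool => (1 : ℝ) := Summable.of_finite
  have hform : ∀ N, (fun ω : ℕ × Bool => 2 ^ ω.1 * a N ω.1 * |dyadicScale ω| ^ (-1 - γ)) =
      fun ω => ((2 : ℝ) ^ ω.1) ^ (-γ) * a N ω.1 * 1 := by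
    intro N
    ext ω
    have hp : (0 : ℝ) < 2 ^ ω.1 := by positivity
    have : ((2 : ℝ) ^ ω.1) ^ (-γ) = 2 ^ ω.1 * (2 ^ ω.1) ^ (-1 - γ) := by
      nth_rewrite 2 [← Real.rpow_one ((2 : ℝ) ^ ω.1)]
      rw [← Real.rpow_add hp]
      congr 1
      ring
    rw [abs_dyadicScale, this]
    ring
  have hsA : ∀ N, Summable fun ω : ℕ × Bool =>
      2 ^ ω.1 * a N ω.1 * |dyadicScale ω| ^ (-1 - γ) := by
    intro N
    rw [hform N]
    exact (hsm N).mul_of_nonneg hsb (hterm0 N) fun _ => zero_le_one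
  refine ⟨fun ω k => 2 ^ ω.1 * c ω.1 ω.2 k, fun ω N => 2 ^ ω.1 * a N ω.1, hcA,
    fun N => ⟨hsA N, ?_⟩, fun x => ?_⟩
  · rw [hform N, ← tsum_mul_tsum_of_summable_norm (hsm N).norm hsb.norm, tsum_bool]
    have := Real.tsum_le_of_sum_le (hterm0 N) (hpart N)
    linarith
  · have hs2 : Summable fun k : ℕ => (((k + 1 : ℕ) : ℝ) ^ 2)⁻¹ :=
      (summable_nat_add_iff 1).2 (Real.summable_nat_pow_inv.2 one_lt_two)
    have hall : Summable fun q : (ℕ × Bool) × ℕ =>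
        2 ^ q.1.1 * c q.1.1 q.1.2 q.2 * block (dyadicScale q.1) q.2 x := by
      refine ((hsA 2).mul_of_nonneg hs2 (fun ω => ?_) fun k => by positivity).of_norm_bounded
        fun q => ?_
      · exact mul_nonneg (mul_nonneg (by positivity) (ha0 _ _)) (by positivity)
      have hτ := one_le_abs_dyadicScale q.1
      have hτ0 : dyadicScale q.1 ≠ 0 := by
        rw [← abs_pos]
        linarith
      have hd := hcA q.1 2 q.2
      have hk : (0 : ℝ) < ((q.2 + 1 : ℕ) : ℝ) ^ 2 := by positivity
      have h2 : ‖(2 : ℂ) ^ q.1.1 * c q.1.1 q.1.2 q.2‖ ≤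
          2 ^ q.1.1 * a 2 q.1.1 * (((q.2 + 1 : ℕ) : ℝ) ^ 2)⁻¹ := by
        rw [← div_eq_mul_inv, le_div_iff₀ hk, Nat.cast_succ, add_comm (q.2 : ℝ) 1]
        exact hd
      have h3 : ‖block (dyadicScale q.1) q.2 x‖ ≤ |dyadicScale q.1| ^ (-1 - γ) := by
        refine (norm_block_le hτ0 _ _).trans ?_
        rw [← Real.rpow_neg_one]
        exact Real.rpow_le_rpow_of_exponent_le hτ (by linarith)
      rw [norm_mul]
      calc _ ≤ 2 ^ q.1.1 * a 2 q.1.1 * (((q.2 + 1 : ℕ) : ℝ) ^ 2)⁻¹ *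
            |dyadicScale q.1| ^ (-1 - γ) :=
            mul_le_mul h2 h3 (norm_nonneg _) ((norm_nonneg _).trans h2)
        _ = _ := by ring
    have hre := (Equiv.prodAssoc ℕ Bool ℕ).symm.hasSum_iff.2 hall.hasSum
    have hfib := hre.prod_fiberwise fun m => (by
      have := hsum m (x / 2 ^ m)
      refine this.congr_fun fun q => ?_
      rw [block_div (by positivity)]
      simp only [Function.comp, Equiv.prodAssoc_symm_apply, dyadicScale]
      push_cast
      ring)
    have hg' := (hasSum_dyadicCutoff x).mul_right (g x)
    rw [one_mul] at hg'
    have heq : (fun m => dyadicPiece g m (x / 2 ^ m)) =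
        fun m => dyadicCutoff m (x / 2 ^ m) * g x := by
      ext m
      rw [dyadicPiece, mul_div_cancel₀ _ (by positivity)]
    rw [heq] at hfib
    rw [← hfib.unique hg']
    exact hall.hasSum

lemma shiftBlockConst_nonneg (b k : ℕ) : 0 ≤ shiftBlockConst b k :=
  Finset.sum_nonneg fun _ _ => mul_nonneg (mul_nonneg (Nat.cast_nonneg _) (zpowConst_nonneg _ _))
    (blockConst_nonneg _ _)

lemma RapidDecay.nonneg {A : ℕ → ℝ} {c : ℕ → ℂ} (hc : RapidDecay A c) (N : ℕ) : 0 ≤ A N :=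
  le_trans (by positivity) (hc N 0)

lemma divDiff_const_mul (w : ℂ) (v : ℝ → ℂ) (z : ℕ → ℝ) (a n : ℕ) :
    divDiff (fun x => w * v x) z a n = w * divDiff v z a n := by
  induction n generalizing a with
  | zero => rfl
  | succ n ih => rw [divDiff, ih, ih, divDiff, ← mul_sub, mul_div_assoc]

section Terms

variable {n : ℕ}

lemma card_Ici_fin (j : Fin (n + 1)) : (Finset.Ici j).card = n - j + 1 := by
  rw [Fin.card_Ici]
  lia

lemma prod_range_eq_prod_Iic {M : Type*} [CommMonoid M] (j : Fin (n + 1)) (H : ℕ → M) :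
    ∏ i ∈ Finset.range (j + 1), H i = ∏ i ∈ Finset.Iic j, H i := by
  rw [Nat.range_succ_eq_Iic, ← Fin.map_valEmbedding_Iic, Finset.prod_map]
  rfl

lemma prod_range_eq_prod_Ici {M : Type*} [CommMonoid M] (j : Fin (n + 1)) (H : ℕ → M) :
    ∏ i ∈ Finset.range (n - j + 1), H (j + i) = ∏ i ∈ Finset.Ici j, H i := by
  have h : (Finset.Ici j).map Fin.valEmbedding = Finset.Ico (j : ℕ) (n + 1) := by
    ext i
    simp only [Finset.mem_map, Finset.mem_Ici, Fin.valEmbedding_apply, Finset.mem_Ico]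
    exact ⟨fun ⟨a, ha, hai⟩ => hai ▸ ⟨ha, a.2⟩, fun ⟨h1, h2⟩ => ⟨⟨i, h2⟩, h1, rfl⟩⟩
  calc _ = ∏ i ∈ Finset.Ico (j : ℕ) (n + 1), H i := by
        rw [Finset.prod_Ico_eq_prod_range]
        congr 2
        lia
    _ = _ := by
        rw [← h, Finset.prod_map]
        rfl

/-- The order carried by each of the `n - j + 1` block factors in a term of total order `γ`. -/
noncomputable def blockOrder (γ : ℝ) (j : Fin (n + 1)) : ℝ :=
  (γ - (n - j : ℕ)) / ((n - j : ℕ) + 1)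

/-- The orders of the factors of a term. -/
noncomputable def termOrder (γ : ℝ) (j : Fin (n + 1)) (b : Fin (n + 1) → ℕ) (i : Fin (n + 1)) :
    ℝ :=
  b i + if j ≤ i then blockOrder γ j else 0

/-- The scalar weights of a term. -/
noncomputable def termWeight (c : ℕ × Bool → ℕ → ℂ) (j : Fin (n + 1))
    (ω : (ℕ × Bool) × (Fin (n + 1) → ℕ)) : ℂ :=
  (-1) ^ (j : ℕ) * if ∀ i, ω.2 i ≠ 0 → i ∈ Finset.Ici j then
    (abelDiff^[n - j] (c ω.1)) (∑ i, ω.2 i) else 0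

/-- The factors of a term. -/
noncomputable def termFactor (j : Fin (n + 1)) (b : Fin (n + 1) → ℕ) (i : Fin (n + 1))
    (ω : (ℕ × Bool) × (Fin (n + 1) → ℕ)) (x : ℝ) : ℂ :=
  shiftI x ^ b i * if j ≤ i then block (dyadicScale ω.1) (ω.2 i) x else 1

/-- One summand in the decomposition of a divided difference. -/
noncomputable def boxTerm (c : ℕ × Bool → ℕ → ℂ) (j : Fin (n + 1)) (b : Fin (n + 1) → ℕ)
    (x : Fin (n + 1) → ℝ) : ℂ :=
  ∑' ω, termWeight c j ω * ∏ i, termFactor j b i ω (x i)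

/-- A constant for the seminorms of the factors of a term. -/
def factorConst (b k : ℕ) : ℝ := shiftBlockConst b k + zpowConst k b

lemma factorConst_nonneg (b k : ℕ) : 0 ≤ factorConst b k :=
  add_nonneg (shiftBlockConst_nonneg b k) (zpowConst_nonneg k b)

lemma blockOrder_mem {γ : ℝ} (h1 : -1 ≤ γ) (h0 : γ ≤ 0) (j : Fin (n + 1)) :
    -1 ≤ blockOrder γ j ∧ blockOrder γ j ≤ 0 := by
  have hd : (0 : ℝ) ≤ (n - j : ℕ) := Nat.cast_nonneg _
  rw [blockOrder]
  constructor
  · rw [le_div_iff₀ (by positivity)]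
    linarith
  · exact div_nonpos_of_nonpos_of_nonneg (by linarith) (by positivity)

lemma sum_termOrder (γ : ℝ) (j : Fin (n + 1)) (b : Fin (n + 1) → ℕ) :
    ∑ i, termOrder γ j b i = (∑ i, b i : ℕ) + γ - (n - j : ℕ) := by
  have hd : (0 : ℝ) ≤ (n - j : ℕ) := Nat.cast_nonneg _
  have h : ∑ i, (if j ≤ i then blockOrder γ j else 0) = γ - (n - j : ℕ) := by
    rw [← Finset.sum_filter, Finset.filter_le_eq_Ici, Finset.sum_const, card_Ici_fin, nsmul_eq_mul,
      blockOrder]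
    push_cast
    field_simp
  simp only [termOrder]
  rw [Finset.sum_add_distrib, h]
  push_cast
  ring

lemma memS_termFactor {γ : ℝ} (h1 : -1 ≤ γ) (h0 : γ ≤ 0) (j : Fin (n + 1))
    (b : Fin (n + 1) → ℕ) (i : Fin (n + 1)) (ω : (ℕ × Bool) × (Fin (n + 1) → ℕ)) :
    MemS (termOrder γ j b i) (termFactor j b i ω) ∧
      ∀ k, SNorm (termOrder γ j b i) k (termFactor j b i ω) ≤
        factorConst (b i) k * (1 + (∑ i, ω.2 i : ℕ)) ^ k *
          if j ≤ i then |dyadicScale ω.1| ^ (-1 - blockOrder γ j) else 1 := by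
  have hle : ω.2 i ≤ ∑ i, ω.2 i := Finset.single_le_sum (fun _ _ => Nat.zero_le _)
    (Finset.mem_univ i)
  have hle' : (ω.2 i : ℝ) ≤ (∑ i, ω.2 i : ℕ) := by exact_mod_cast hle
  unfold termFactor termOrder
  by_cases hj : j ≤ i
  · simp only [hj, if_true]
    obtain ⟨hb1, hb0⟩ := blockOrder_mem h1 h0 j
    obtain ⟨hm, hn⟩ := memS_shiftI_pow_mul_block (one_le_abs_dyadicScale ω.1) hb1 hb0 (b i) (ω.2 i)
    refine ⟨hm, fun k => (hn k).trans ?_⟩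
    have := factorConst_nonneg (b i) k
    have : shiftBlockConst (b i) k ≤ factorConst (b i) k :=
      le_add_of_nonneg_right (zpowConst_nonneg _ _)
    gcongr
  · simp only [hj, if_false, add_zero, mul_one]
    obtain ⟨hm, hn⟩ := memS_shiftI_pow (b i)
    refine ⟨hm, fun k => (hn k).trans ?_⟩
    have h1 : zpowConst k (b i) ≤ factorConst (b i) k :=
      le_add_of_nonneg_left (shiftBlockConst_nonneg _ _)
    exact h1.trans (le_mul_of_one_le_right (factorConst_nonneg _ _)
      (one_le_pow₀ (le_add_of_nonneg_right (Nat.cast_nonneg _))))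

lemma prod_SNorm_termFactor_le {γ : ℝ} (h1 : -1 ≤ γ) (h0 : γ ≤ 0) (j : Fin (n + 1))
    (b k : Fin (n + 1) → ℕ) (ω : (ℕ × Bool) × (Fin (n + 1) → ℕ)) :
    ∏ i, SNorm (termOrder γ j b i) (k i) (termFactor j b i ω) ≤
      (∏ i, factorConst (b i) (k i)) * (1 + (∑ i, ω.2 i : ℕ)) ^ (∑ i, k i) *
        |dyadicScale ω.1| ^ (-1 - γ) := by
  refine (Finset.prod_le_prod (fun _ _ => SNorm_nonneg _ _ _) fun i _ =>
    (memS_termFactor h1 h0 j b i ω).2 (k i)).trans_eq ?_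
  rw [Finset.prod_mul_distrib, Finset.prod_mul_distrib, Finset.prod_pow_eq_pow_sum,
    ← Finset.prod_filter, Finset.filter_le_eq_Ici, Finset.prod_const, card_Ici_fin,
    ← Real.rpow_natCast (_ ^ _) (n - j + 1), ← Real.rpow_mul (abs_nonneg _)]
  congr 2
  have hd : (0 : ℝ) ≤ (n - j : ℕ) := Nat.cast_nonneg _
  rw [blockOrder]
  push_cast
  field_simp
  ring

lemma norm_termWeight_mul_le {c : ℕ × Bool → ℕ → ℂ} {A : ℕ × Bool → ℕ → ℝ}
    (hc : ∀ ω, RapidDecay (A ω) (c ω)) (j : Fin (n + 1)) (N : ℕ)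
    (ω : (ℕ × Bool) × (Fin (n + 1) → ℕ)) :
    ‖termWeight c j ω‖ * (1 + (∑ i, ω.2 i : ℕ)) ^ N ≤ 2 ^ (n - j : ℕ) * A ω.1 N := by
  have h := (hc ω.1).iterate_abelDiff (n - j)
  rw [termWeight, norm_mul, norm_pow, norm_neg, norm_one, one_pow, one_mul]
  split_ifs
  · exact h N _
  · simpa using h.nonneg N

/-- The sum of the decay weights over all exponents. -/
noncomputable def decaySum (n : ℕ) : ℝ :=
  ∑' a : Fin (n + 1) → ℕ, (((1 : ℝ) + (∑ i, a i : ℕ)) ^ (n + 2))⁻¹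

lemma decaySum_nonneg (n : ℕ) : 0 ≤ decaySum n := tsum_nonneg fun _ => by positivity

lemma summable_term {γ : ℝ} (h1 : -1 ≤ γ) (h0 : γ ≤ 0) {c : ℕ × Bool → ℕ → ℂ}
    {A : ℕ × Bool → ℕ → ℝ} (hc : ∀ ω, RapidDecay (A ω) (c ω))
    (hA : ∀ N, Summable fun ω => A ω N * |dyadicScale ω| ^ (-1 - γ))
    (j : Fin (n + 1)) (b k : Fin (n + 1) → ℕ) :
    Summable (fun ω => ‖termWeight c j ω‖ *
        ∏ i, SNorm (termOrder γ j b i) (k i) (termFactor j b i ω)) ∧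
      ∑' ω, ‖termWeight c j ω‖ * ∏ i, SNorm (termOrder γ j b i) (k i) (termFactor j b i ω) ≤
        2 ^ (n - j : ℕ) * (∏ i, factorConst (b i) (k i)) * decaySum n *
          ∑' ω, A ω (n + (∑ i, k i) + 2) * |dyadicScale ω| ^ (-1 - γ) := by
  set N := n + (∑ i, k i) + 2 with hN
  set P : ℝ := 2 ^ (n - j : ℕ) * ∏ i, factorConst (b i) (k i) with hP
  have hP0 : 0 ≤ ∏ i, factorConst (b i) (k i) :=
    Finset.prod_nonneg fun _ _ => factorConst_nonneg _ _
  have hA0 : ∀ ω, 0 ≤ A ω N * |dyadicScale ω| ^ (-1 - γ) := fun ω =>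
    mul_nonneg ((hc ω).nonneg N) (by positivity)
  have hs := summable_inv_one_add_sum_pow n
  have hprod := ((hA N).mul_of_nonneg hs hA0 fun _ => by positivity).mul_left P
  have hle : ∀ ω, ‖termWeight c j ω‖ *
      ∏ i, SNorm (termOrder γ j b i) (k i) (termFactor j b i ω) ≤
      P * (A ω.1 N * |dyadicScale ω.1| ^ (-1 - γ) *
        (((1 : ℝ) + (∑ i, ω.2 i : ℕ)) ^ (n + 2))⁻¹) := by
    intro ω
    refine (mul_le_mul_of_nonneg_left (prod_SNorm_termFactor_le h1 h0 j b k ω)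
      (norm_nonneg _)).trans ?_
    have hw := norm_termWeight_mul_le hc j N ω
    set u : ℝ := 1 + (∑ i, ω.2 i : ℕ) with hu
    have hu0 : 0 < u := by positivity
    have hw' : ‖termWeight c j ω‖ * u ^ (∑ i, k i) ≤
        2 ^ (n - j : ℕ) * A ω.1 N * (u ^ (n + 2))⁻¹ := by
      rw [← div_eq_mul_inv, le_div_iff₀ (by positivity), mul_assoc, ← pow_add]
      rwa [show (∑ i, k i) + (n + 2) = N by lia]
    calc _ = (∏ i, factorConst (b i) (k i)) * |dyadicScale ω.1| ^ (-1 - γ) *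
          (‖termWeight c j ω‖ * u ^ (∑ i, k i)) := by ring
      _ ≤ (∏ i, factorConst (b i) (k i)) * |dyadicScale ω.1| ^ (-1 - γ) *
          (2 ^ (n - j : ℕ) * A ω.1 N * (u ^ (n + 2))⁻¹) := by gcongr
      _ = _ := by
          rw [hP]
          ring
  have hsum := hprod.of_nonneg_of_le (fun ω => mul_nonneg (norm_nonneg _)
    (Finset.prod_nonneg fun _ _ => SNorm_nonneg _ _ _)) hle
  refine ⟨hsum, (hsum.tsum_le_tsum hle hprod).trans_eq ?_⟩
  rw [tsum_mul_left, ← tsum_mul_tsum_of_summable_norm (hA N).norm hs.norm, decaySum]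
  ring

lemma boxTerm_eq_mul_divDiff {γ : ℝ} (h1 : -1 ≤ γ) (h0 : γ ≤ 0) {c : ℕ × Bool → ℕ → ℂ}
    {A : ℕ × Bool → ℕ → ℝ} (hc : ∀ ω, RapidDecay (A ω) (c ω))
    (hA : ∀ N, Summable fun ω => A ω N * |dyadicScale ω| ^ (-1 - γ)) {g : ℝ → ℂ}
    (hg : ∀ x, HasSum (fun q : (ℕ × Bool) × ℕ => c q.1 q.2 * block (dyadicScale q.1) q.2 x) (g x))
    (j : Fin (n + 1)) (b : Fin (n + 1) → ℕ) {z : ℕ → ℝ} (hz : Set.InjOn z (Set.Icc 0 n)) :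
    boxTerm c j b (fun i => z i) =
      (-1) ^ (j : ℕ) * (∏ i : Fin (n + 1), shiftI (z i) ^ b i) * divDiff g z j (n - j) := by
  have hzj : Set.InjOn z (Set.Icc (j : ℕ) (j + (n - j))) :=
    hz.mono (Set.Icc_subset_Icc (Nat.zero_le _) (by lia))
  have hτ : ∀ ω, dyadicScale ω ≠ 0 := fun ω => by
    rw [← abs_pos]
    linarith [one_le_abs_dyadicScale ω]
  have hsumm := summable_box (fun i ω => (memS_termFactor h1 h0 j b i ω).1)
    (summable_term h1 h0 hc hA j b 0).1 fun i => z i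
  have hd := divDiff_hasSum z hg j (n - j)
  simp only [divDiff_const_mul, divDiff_block (hτ _) _ _ _ hzj] at hd
  have hd' := hd.prod_fiberwise fun ω => (hd.summable.prod_factor ω).hasSum
  rw [boxTerm, hsumm.tsum_prod, ← hd'.tsum_eq, ← tsum_mul_left]
  refine tsum_congr fun ω => ?_
  have hE : ∀ (i : Fin (n + 1)) k, ‖block (dyadicScale ω) k (z i)‖ ≤ 1 := fun i k =>
    (norm_block_le (hτ ω) _ _).trans (inv_le_one_of_one_le₀ (one_le_abs_dyadicScale ω))
  have hb := (hc ω).hasSum_blocks hE (Finset.Ici j) (n - j)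
  simp only [prod_range_eq_prod_Ici j fun i =>
    PowerSeries.mk fun k => block (dyadicScale ω) k (z i)]
  rw [← hb.tsum_eq, ← tsum_mul_left]
  refine tsum_congr fun a => ?_
  have hprod : ∏ i : Fin (n + 1), termFactor j b i (ω, a) (z i) =
      (∏ i : Fin (n + 1), shiftI (z i) ^ b i) *
        ∏ i ∈ Finset.Ici j, block (dyadicScale ω) (a i) (z i) := by
    simp only [termFactor]
    rw [Finset.prod_mul_distrib, ← Finset.prod_filter, Finset.filter_le_eq_Ici]
  rw [hprod, termWeight]
  split_ifs <;> ring

lemma divDiff_shiftI_pow_eq_sum {z : ℕ → ℝ} (hz : Set.InjOn z (Set.Icc 0 n)) {p : ℕ}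
    (hp : n ≤ p) (j : Fin (n + 1)) :
    divDiff (fun x => shiftI x ^ p) z 0 j = (-1) ^ (j : ℕ) *
      ∑ b ∈ Finset.piAntidiag (Finset.Iic j) (p - j),
        ∏ i : Fin (n + 1), shiftI (z i) ^ b i := by
  rw [divDiff_shiftI_pow (by lia) (hz.mono (Set.Icc_subset_Icc le_rfl (by lia))),
    prod_range_eq_prod_Iic j fun i => PowerSeries.mk fun k => shiftI (z i) ^ k,
    coeff_prod_mk (fun (i : Fin (n + 1)) k => shiftI (z i) ^ k)]
  congr 1
  refine Finset.sum_congr rfl fun b hb => Finset.prod_subset (Finset.subset_univ _) fun i _ hi => ?_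
  rw [not_not.1 (mt ((Finset.mem_piAntidiag.1 hb).2 i) hi), pow_zero]

/-- The index set of the decomposition. -/
def termIndex (n p : ℕ) : Finset (Σ _ : Fin (n + 1), Fin (n + 1) → ℕ) :=
  Finset.univ.sigma fun j => Finset.piAntidiag (Finset.Iic j) (p - j)

lemma sum_eq_of_mem_termIndex {p : ℕ} {t : Σ _ : Fin (n + 1), Fin (n + 1) → ℕ}
    (ht : t ∈ termIndex n p) : ∑ i, t.2 i = p - t.1 := by
  have h := Finset.mem_piAntidiag.1 (Finset.mem_sigma.1 ht).2
  rw [← h.1]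
  exact (Finset.sum_subset (Finset.subset_univ _) fun i _ hi => not_not.1 (mt (h.2 i) hi)).symm

lemma divDiff_eq_sum_boxTerm {γ : ℝ} (h1 : -1 ≤ γ) (h0 : γ ≤ 0) {c : ℕ × Bool → ℕ → ℂ}
    {A : ℕ × Bool → ℕ → ℝ} (hc : ∀ ω, RapidDecay (A ω) (c ω))
    (hA : ∀ N, Summable fun ω => A ω N * |dyadicScale ω| ^ (-1 - γ)) {g : ℝ → ℂ}
    (hg : ∀ x, HasSum (fun q : (ℕ × Bool) × ℕ => c q.1 q.2 * block (dyadicScale q.1) q.2 x) (g x))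
    {p : ℕ} (hp : n ≤ p) {z : ℕ → ℝ} (hz : Set.InjOn z (Set.Icc 0 n)) :
    divDiff (fun x => shiftI x ^ p * g x) z 0 n =
      ∑ t ∈ termIndex n p, boxTerm c t.1 t.2 fun i => z i := by
  rw [divDiff_mul _ _ _ _ (by simpa using hz), Finset.Nat.sum_antidiagonal_eq_sum_range_succ_mk,
    Finset.sum_range, termIndex, Finset.sum_sigma]
  refine Finset.sum_congr rfl fun j _ => ?_
  dsimp only
  rw [divDiff_shiftI_pow_eq_sum hz hp, Finset.mul_sum, Finset.sum_mul, zero_add]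
  exact Finset.sum_congr rfl fun b _ => (boxTerm_eq_mul_divDiff h1 h0 hc hA hg j b hz).symm

lemma continuous_boxTerm {γ : ℝ} (h1 : -1 ≤ γ) (h0 : γ ≤ 0) {c : ℕ × Bool → ℕ → ℂ}
    {A : ℕ × Bool → ℕ → ℝ} (hc : ∀ ω, RapidDecay (A ω) (c ω))
    (hA : ∀ N, Summable fun ω => A ω N * |dyadicScale ω| ^ (-1 - γ)) (j : Fin (n + 1))
    (b : Fin (n + 1) → ℕ) : Continuous (boxTerm c j b) :=
  continuous_box (fun i ω => (memS_termFactor h1 h0 j b i ω).1) (summable_term h1 h0 hc hA j b 0).1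

lemma IsDivDiff.eq_sum_boxTerm {γ : ℝ} (h1 : -1 ≤ γ) (h0 : γ ≤ 0) {c : ℕ × Bool → ℕ → ℂ}
    {A : ℕ × Bool → ℕ → ℝ} (hc : ∀ ω, RapidDecay (A ω) (c ω))
    (hA : ∀ N, Summable fun ω => A ω N * |dyadicScale ω| ^ (-1 - γ)) {g : ℝ → ℂ}
    (hg : ∀ x, HasSum (fun q : (ℕ × Bool) × ℕ => c q.1 q.2 * block (dyadicScale q.1) q.2 x) (g x))
    {p : ℕ} (hp : n ≤ p) {F : (m : ℕ) → (Fin (m + 1) → ℝ) → ℂ}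
    (hF : IsDivDiff (fun x => shiftI x ^ p * g x) F) :
    F n = fun x => ∑ t ∈ termIndex n p, boxTerm c t.1 t.2 x := by
  refine eq_of_eq_on_injective (hF.2.1 n)
    (continuous_finsetSum _ fun t _ => continuous_boxTerm h1 h0 hc hA t.1 t.2) fun x hx => ?_
  let z : ℕ → ℝ := fun i => if h : i < n + 1 then x ⟨i, h⟩ else 0
  have hzx : (fun i : Fin (n + 1) => z i) = x := by
    ext i
    exact dif_pos i.2
  have hz : Set.InjOn z (Set.Icc 0 n) := by
    intro i hi i' hi' h
    have h1 : i < n + 1 := Nat.lt_succ_of_le hi.2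
    have h2 : i' < n + 1 := Nat.lt_succ_of_le hi'.2
    simp only [z, h1, h2, dif_pos] at h
    exact congrArg Fin.val (hx h)
  have h := hF.eq_divDiff (z := z) 0 n (by simpa using hz)
  rw [divDiff_eq_sum_boxTerm h1 h0 hc hA hg hp hz] at h
  simpa only [zero_add, hzx] using h

end Terms

open scoped ENNReal in
/-- Let `n ≥ 0`, `α ≥ n` real, and `f ∈ T^α(ℝ)`. Then there exist
finitely many tuples `β⁽¹⁾, …, β⁽ᴸ⁾ ∈ ℝ^{n+1}` with `Σ_j β⁽ⁱ⁾_j = α − n`, and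
functions `φ_i ∈ S^{β⁽ⁱ⁾_0}(ℝ) ⊠ᵢ ⋯ ⊠ᵢ S^{β⁽ⁱ⁾_n}(ℝ)` with `f^{[n]} = φ_1 + ⋯ + φ_L`,
where for all `k_0, …, k_n ≥ 0` each `φ_i` satisfies
`‖φ_i‖_{k_0,…,k_n} ≤ C(k) · Σ_{r=0}^{n+k_0+⋯+k_n+2} ‖f‖_{T^α,r}` with `C(k)`
independent of `f`. -/
theorem stmt6 (n : ℕ) (α : ℝ) (hα : (n : ℝ) ≤ α) :
    ∃ C : (Fin (n + 1) → ℕ) → ℝ, (∀ k, 0 ≤ C k) ∧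
      ∀ (f : ℝ → ℂ) (F : (m : ℕ) → (Fin (m + 1) → ℝ) → ℂ),
        MemT α f → IsDivDiff f F →
        ∃ (L : ℕ) (β : Fin L → Fin (n + 1) → ℝ)
          (φ : Fin L → ((Fin (n + 1) → ℝ) → ℂ)),
          (∀ i, ∑ j, β i j = α - n) ∧
          (∀ i, MemBox (β i) (φ i)) ∧
          (∀ lam, F n lam = ∑ i, φ i lam) ∧
          (∀ (i : Fin L) (k : Fin (n + 1) → ℕ),
            boxNorm (β i) k (φ i) ≤
              ENNReal.ofReal (C k * ∑ r ∈ Finset.range (n + (∑ j, k j) + 3), TNorm α r f)) := by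
  set p := ⌈α⌉₊ with hp
  have hα0 : 0 ≤ α := n.cast_nonneg.trans hα
  have hnp : n ≤ p := by exact_mod_cast hα.trans (Nat.le_ceil α)
  set γ : ℝ := ((-p : ℤ) : ℝ) + α with hγ
  have hγp : γ = α - p := by
    rw [hγ]
    push_cast
    ring
  have h1 : -1 < γ := by linarith [Nat.ceil_lt_add_one hα0]
  have h0 : γ ≤ 0 := by linarith [Nat.le_ceil α]
  obtain ⟨C, hC0, hC⟩ := exists_dyadic_expansion h1 h0
  set D : ℕ → ℝ := fun N => ∑ r ∈ Finset.range (N + 1),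
    ∑ i ∈ Finset.range (r + 1), (r.choose i : ℝ) * zpowConst i (-p) with hD
  have hD0 : ∀ N, 0 ≤ D N := fun N => Finset.sum_nonneg fun r _ => Finset.sum_nonneg fun i _ =>
    mul_nonneg (Nat.cast_nonneg _) (zpowConst_nonneg _ _)
  set Q : (Σ _ : Fin (n + 1), Fin (n + 1) → ℕ) → (Fin (n + 1) → ℕ) → ℝ := fun t k =>
    2 ^ (n - t.1 : ℕ) * (∏ i, factorConst (t.2 i) (k i)) * decaySum n *
      (C (n + (∑ i, k i) + 2) * D (n + (∑ i, k i) + 2)) with hQ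
  have hQ0 : ∀ t k, 0 ≤ Q t k := fun t k =>
    mul_nonneg (mul_nonneg (mul_nonneg (by positivity)
      (Finset.prod_nonneg fun _ _ => factorConst_nonneg _ _)) (decaySum_nonneg n))
      (mul_nonneg (hC0 _) (hD0 _))
  refine ⟨fun k => ∑ t ∈ termIndex n p, Q t k, fun k => Finset.sum_nonneg fun t _ => hQ0 t k,
    fun f F hf hF => ?_⟩
  obtain ⟨hg, hgn⟩ := hf.shiftI_zpow_mul (-p)
  set g : ℝ → ℂ := fun x => shiftI x ^ (-p : ℤ) * f x with hgdef
  have hfg : f = fun x => shiftI x ^ p * g x := by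
    ext x
    rw [hgdef]
    dsimp only
    rw [zpow_neg, zpow_natCast, mul_inv_cancel_left₀ (pow_ne_zero _ (shiftI_ne_zero x))]
  have hgN : ∀ N, ∑ r ∈ Finset.range (N + 1), TNorm γ r g ≤
      D N * ∑ r ∈ Finset.range (N + 1), TNorm α r f := by
    intro N
    rw [hD, Finset.sum_mul]
    refine Finset.sum_le_sum fun r hr => (hgn r).trans (mul_le_mul_of_nonneg_left ?_ ?_)
    · exact Finset.sum_le_sum_of_subset_of_nonneg
        (Finset.range_subset_range.2 (Finset.mem_range.1 hr)) fun i _ _ => TNorm_nonneg _ _ _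
    · exact Finset.sum_nonneg fun i _ => mul_nonneg (Nat.cast_nonneg _) (zpowConst_nonneg _ _)
  obtain ⟨c, A, hc, hA, hsum⟩ := hC g hg
  have hA' := fun N => (hA N).1
  have hm := fun (t : Σ _ : Fin (n + 1), Fin (n + 1) → ℕ) i ω =>
    (memS_termFactor h1.le h0 t.1 t.2 i ω).1
  have hs := fun (t : Σ _ : Fin (n + 1), Fin (n + 1) → ℕ) k =>
    (summable_term h1.le h0 hc hA' t.1 t.2 k).1
  let e := (termIndex n p).equivFin.symm
  refine ⟨(termIndex n p).card, fun i => termOrder γ (e i).1.1 (e i).1.2,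
    fun i => boxTerm c (e i).1.1 (e i).1.2, fun i => ?_, fun i => ?_, fun x => ?_, fun i k => ?_⟩
  · have hle : ((e i).1.1 : ℕ) ≤ n := Nat.le_of_lt_succ (e i).1.1.2
    rw [sum_termOrder, sum_eq_of_mem_termIndex (e i).2, hγp, Nat.cast_sub hle,
      Nat.cast_sub (hle.trans hnp)]
    ring
  · exact ⟨_, _, _, _, isBoxRep_of_summable (hm _) (hs _)⟩
  · rw [(hfg ▸ hF : IsDivDiff (fun x => shiftI x ^ p * g x) F).eq_sum_boxTerm h1.le h0 hc hA'
      hsum hnp, e.sum_comp fun t => boxTerm c t.1.1 t.1.2 x]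
    exact (Finset.sum_coe_sort (termIndex n p) fun t => boxTerm c t.1 t.2 x).symm
  · refine (boxNorm_le_tsum (hm _) (hs _) k).trans (ENNReal.ofReal_le_ofReal ?_)
    set N := n + (∑ i, k i) + 2 with hN
    have hT0 : 0 ≤ ∑ r ∈ Finset.range (N + 1), TNorm α r f :=
      Finset.sum_nonneg fun r _ => TNorm_nonneg _ _ _
    refine (summable_term h1.le h0 hc hA' _ _ k).2.trans ?_
    calc _ ≤ 2 ^ (n - (e i).1.1 : ℕ) * (∏ j, factorConst ((e i).1.2 j) (k j)) * decaySum n *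
          (C N * (D N * ∑ r ∈ Finset.range (N + 1), TNorm α r f)) := by
          refine mul_le_mul_of_nonneg_left ((hA N).2.trans
            (mul_le_mul_of_nonneg_left (hgN N) (hC0 N))) ?_
          exact mul_nonneg (mul_nonneg (by positivity)
            (Finset.prod_nonneg fun _ _ => factorConst_nonneg _ _)) (decaySum_nonneg n)
      _ = Q (e i).1 k * ∑ r ∈ Finset.range (N + 1), TNorm α r f := by
          rw [hQ]
          ring
      _ ≤ _ := mul_le_mul_of_nonneg_right
          (Finset.single_le_sum (f := fun t => Q t k) (fun t _ => hQ0 t k) (e i).2) hT0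
end

section
/- Let n ≥ 0 and let f, g ∈ C^n(ℝ) be complex-valued. Then the divided differences satisfy the Leibniz rule (f·g)^{[n]}(λ_0, …, λ_n) = Σ_{l=0}^{n} f^{[l]}(λ_0, …, λ_l) · g^{[n−l]}(λ_l, …, λ_n) for all λ_0, …, λ_n ∈ ℝ. -/
noncomputable section

/-- `F` is the sequence of divided differences of `f` up to order `n`: `F 0 = f`, each
`F m` with `m ≤ n` is continuous, and the divided-difference recursion holds off the
diagonal for orders up to `n`. -/
def IsDivDiffUpTo (n : ℕ) (f : ℝ → ℂ) (F : (m : ℕ) → (Fin (m + 1) → ℝ) → ℂ) : Prop :=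
  (∀ x : Fin 1 → ℝ, F 0 x = f (x 0)) ∧
  (∀ m, m ≤ n → Continuous (F m)) ∧
  (∀ m, m + 1 ≤ n → ∀ x : Fin (m + 2) → ℝ, x 0 ≠ x (Fin.last (m + 1)) →
    F (m + 1) x = (F m (fun i => x i.succ) - F m (fun i => x i.castSucc)) /
      ((x 0 - x (Fin.last (m + 1)) : ℝ) : ℂ))

/-- The points with two prescribed coordinates distinct are dense. -/
theorem dense_setOf_apply_ne {ι : Type*} {i j : ι} (hij : i ≠ j) :
    Dense {x : ι → ℝ | x i ≠ x j} := by
  classical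
  intro x
  have hc : Continuous fun t : ℝ => Function.update x i t :=
    continuous_const.update i continuous_id
  have hm : Set.MapsTo (fun t : ℝ => Function.update x i t) {x j}ᶜ
      {y : ι → ℝ | y i ≠ y j} := by
    intro t ht
    simpa [Function.update_of_ne hij.symm] using ht
  simpa using map_mem_closure hc (dense_compl_singleton (x j) (x i)) hm

namespace IsDivDiffUpTo

variable {n : ℕ} {f : ℝ → ℂ} {F : (m : ℕ) → (Fin (m + 1) → ℝ) → ℂ}

/-- A divided difference of consecutive terms of a sequence depends continuously on the sequence. -/
theorem continuous_window (hF : IsDivDiffUpTo n f F) {m : ℕ} (hm : m ≤ n) (k : ℕ) :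
    Continuous fun x : ℕ → ℝ => F m fun i => x (k + i) :=
  (hF.2.1 m hm).comp (continuous_pi fun _ => continuous_apply _)

/-- The divided-difference recursion in multiplied-out form, valid on the diagonal too. -/
theorem sub_eq_mul (hF : IsDivDiffUpTo n f F) {m : ℕ} (hm : m + 1 ≤ n) (k : ℕ) (x : ℕ → ℝ) :
    (F m fun i => x (k + 1 + i)) - (F m fun i => x (k + i)) =
      ((x k - x (k + m + 1) : ℝ) : ℂ) * F (m + 1) fun i => x (k + i) := by
  have hc : Continuous fun x : ℕ → ℝ => ((x k - x (k + m + 1) : ℝ) : ℂ) :=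
    Complex.continuous_ofReal.comp ((continuous_apply k).sub (continuous_apply _))
  refine congrFun (Continuous.ext_on (dense_setOf_apply_ne (show k ≠ k + m + 1 by omega))
    ((hF.continuous_window (by omega) (k + 1)).sub (hF.continuous_window (by omega) k))
    (hc.mul (hF.continuous_window hm k)) ?_) x
  intro y hy
  have hy' : ((y k - y (k + m + 1) : ℝ) : ℂ) ≠ 0 :=
    Complex.ofReal_ne_zero.mpr (sub_ne_zero.mpr hy)
  have h := hF.2.2 m hm (fun i => y (k + i)) hy
  have e : (fun i : Fin (m + 1) => y (k + 1 + i)) = fun i => y (k + i.succ) := by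
    funext i
    congr 1
    simp only [Fin.val_succ]
    omega
  change (F m fun i => y (k + 1 + i)) - (F m fun i => y (k + i)) =
    ((y k - y (k + m + 1) : ℝ) : ℂ) * F (m + 1) fun i => y (k + i)
  rw [e, h]
  exact (mul_div_cancel₀ _ hy').symm

/-- The Leibniz rule for divided differences of initial segments of a sequence. -/
theorem mul_window {g : ℝ → ℂ} {G P : (m : ℕ) → (Fin (m + 1) → ℝ) → ℂ}
    (hF : IsDivDiffUpTo n f F) (hG : IsDivDiffUpTo n g G)
    (hP : IsDivDiffUpTo n (fun x => f x * g x) P) {m : ℕ} (hm : m ≤ n) (x : ℕ → ℝ) :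
    (P m fun i => x (0 + i)) = ∑ l ∈ Finset.range (m + 1),
      (F l fun i => x (0 + i)) * G (m - l) fun i => x (l + i) := by
  induction m generalizing x with
  | zero => simp [hF.1, hG.1, hP.1]
  | succ m ih =>
    have hc : Continuous fun x : ℕ → ℝ => ∑ l ∈ Finset.range (m + 1 + 1),
        (F l fun i => x (0 + i)) * G (m + 1 - l) fun i => x (l + i) := by
      refine continuous_finsetSum _ fun l hl => ?_
      have := Finset.mem_range.mp hl
      exact (hF.continuous_window (by omega) 0).mul (hG.continuous_window (by omega) l)
    refine congrFun (Continuous.ext_on (dense_setOf_apply_ne (show 0 ≠ m + 1 by omega))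
      (hP.continuous_window hm 0) hc ?_) x
    intro y hy
    have hy' : ((y 0 - y (m + 1) : ℝ) : ℂ) ≠ 0 :=
      Complex.ofReal_ne_zero.mpr (sub_ne_zero.mpr hy)
    refine mul_left_cancel₀ hy' ?_
    have hrec := hP.sub_eq_mul hm 0 y
    have htail := ih (by omega) fun i => y (1 + i)
    simp only [zero_add] at hrec htail ⊢
    have hinit := ih (by omega) y
    simp only [zero_add] at hinit
    rw [← hrec, htail, hinit, ← Finset.sum_sub_distrib]
    have hterm : ∀ l ∈ Finset.range (m + 1),
        (F l fun i => y (1 + i)) * (G (m - l) fun i => y (1 + (l + i))) -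
          (F l fun i => y i) * (G (m - l) fun i => y (l + i)) =
        ((y 0 - y (l + 1) : ℝ) : ℂ) *
            ((F (l + 1) fun i => y i) * G (m + 1 - (l + 1)) fun i => y (l + 1 + i)) +
          ((y l - y (m + 1) : ℝ) : ℂ) *
            ((F l fun i => y i) * G (m + 1 - l) fun i => y (l + i)) := by
      intro l hl
      have hl := Finset.mem_range.mp hl
      have hFl := hF.sub_eq_mul (m := l) (by omega) 0 y
      have hGl := hG.sub_eq_mul (m := m - l) (by omega) l y
      simp only [zero_add] at hFl
      rw [show l + (m - l) + 1 = m + 1 by omega] at hGl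
      rw [show m + 1 - (l + 1) = m - l by omega, show m + 1 - l = m - l + 1 by omega]
      simp only [show ∀ i : ℕ, 1 + (l + i) = l + 1 + i by intro i; omega]
      linear_combination (G (m - l) fun i => y (l + 1 + i)) * hFl + (F l fun i => y i) * hGl
    rw [Finset.sum_congr rfl hterm, Finset.sum_add_distrib, Finset.mul_sum]
    have hleft := Finset.sum_range_succ' (fun l => ((y 0 - y l : ℝ) : ℂ) *
      ((F l fun i => y i) * G (m + 1 - l) fun i => y (l + i))) (m + 1)
    have hright := Finset.sum_range_succ (fun l => ((y l - y (m + 1) : ℝ) : ℂ) *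
      ((F l fun i => y i) * G (m + 1 - l) fun i => y (l + i))) (m + 1)
    simp only [sub_self, Complex.ofReal_zero, zero_mul, add_zero] at hleft hright
    rw [← hleft, ← hright, ← Finset.sum_add_distrib]
    refine Finset.sum_congr rfl fun l _ => ?_
    push_cast
    ring

end IsDivDiffUpTo

/-- Let `n ≥ 0` and `f, g ∈ C^n(ℝ)` complex-valued. Then the divided
differences satisfy the Leibniz rule
`(f·g)^{[n]}(λ_0, …, λ_n) = Σ_{l=0}^n f^{[l]}(λ_0, …, λ_l) g^{[n−l]}(λ_l, …, λ_n)`. -/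
theorem stmt13 (n : ℕ) (f g : ℝ → ℂ)
    (hf : ContDiff ℝ (n : ℕ∞) f) (hg : ContDiff ℝ (n : ℕ∞) g)
    (F G P : (m : ℕ) → (Fin (m + 1) → ℝ) → ℂ)
    (hF : IsDivDiffUpTo n f F) (hG : IsDivDiffUpTo n g G)
    (hP : IsDivDiffUpTo n (fun x => f x * g x) P)
    (lam : Fin (n + 1) → ℝ) :
    P n lam = ∑ l : Fin (n + 1),
      F l.val (fun i : Fin (l.val + 1) =>
        lam ⟨i.val, by have h1 := l.isLt; have h2 := i.isLt; omega⟩) *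
      G (n - l.val) (fun i : Fin (n - l.val + 1) =>
        lam ⟨l.val + i.val, by have h1 := l.isLt; have h2 := i.isLt; omega⟩) := by
  have h := hF.mul_window hG hP le_rfl fun k => if hk : k < n + 1 then lam ⟨k, hk⟩ else 0
  rw [← Fin.sum_univ_eq_sum_range (fun l => (F l fun i => _) * G (n - l) fun i => _)] at h
  have hl : (fun i : Fin (n + 1) => if hk : 0 + (i : ℕ) < n + 1 then lam ⟨0 + i, hk⟩ else 0) =
      lam := by
    funext i
    simp [i.isLt]
  rw [hl] at h
  rw [h]
  refine Finset.sum_congr rfl fun l _ => ?_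
  congr 2
  · funext i
    have h1 := l.isLt
    have h2 := i.isLt
    rw [dif_pos (by omega)]
    simp only [zero_add]
  · funext i
    have h1 := l.isLt
    have h2 := i.isLt
    rw [dif_pos (by omega)]

end
end
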